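/- arXiv:1802.01712 — 4 statements merged into one kernel-verified Lean document; each statement's English description precedes it below -/
import Mathlib

section
/- Let P₀ be a finite antichain with elements x₁,…,x_{m₀}, and let m₁,…,m_{m₀} be nonnegative integers of which at most one is odd. Then the sign-imbalance of the lexicographic sum of disjoint chains of cardinalities m₁,…,m_{m₀} over P₀ is L₋(P₀; m₁,…,m_{m₀}) = (∑_{1≤i≤m₀} ⌊mᵢ/2⌋)! / ∏_{1≤i≤m₀} ⌊mᵢ/2⌋!. -/
open scoped Classical

/-- Underlying set of the lexicographic sum over `Fin m₀` of chains `C i` of `m i` elements. -/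
abbrev LexSumChains (m₀ : ℕ) (m : Fin m₀ → ℕ) : Type := Σ i : Fin m₀, Fin (m i)

/-- The order of the lexicographic sum `P₀ * (C₁, …, C_{m₀})` of chains over the poset
`(Fin m₀, r0)`: within a chain elements keep their order, and an element of `C i` is below an
element of `C i'` (for `i ≠ i'`) iff `xᵢ ≺₀ x_{i'}`. -/
def lexRel {m₀ : ℕ} (r0 : Fin m₀ → Fin m₀ → Prop) (m : Fin m₀ → ℕ)
    (x y : LexSumChains m₀ m) : Prop :=
  (x.1 = y.1 ∧ (x.2 : ℕ) ≤ (y.2 : ℕ)) ∨ (x.1 ≠ y.1 ∧ r0 x.1 y.1)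

/-- `φ` is (the isotone bijection corresponding to) a linearization of the lexicographic sum. -/
def IsLin {m₀ : ℕ} (r0 : Fin m₀ → Fin m₀ → Prop) (m : Fin m₀ → ℕ)
    (φ : LexSumChains m₀ m ≃ Fin (∑ i, m i)) : Prop :=
  ∀ x y, lexRel r0 m x y → φ x ≤ φ y

/-- `b` is the reference ordering, listing the elements `x_{i,j}` in lexicographic order
of the pairs `(i,j)`. -/
def IsRef {m₀ : ℕ} (m : Fin m₀ → ℕ) (b : LexSumChains m₀ m ≃ Fin (∑ i, m i)) : Prop :=
  ∀ x y : LexSumChains m₀ m,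
    (x.1 < y.1 ∨ (x.1 = y.1 ∧ (x.2 : ℕ) ≤ (y.2 : ℕ))) → b x ≤ b y

/-- `L₊(P₀; m₁, …, m_{m₀})`, the number of linearizations of the lexicographic sum of chains. -/
noncomputable def Lplus (m₀ : ℕ) (r0 : Fin m₀ → Fin m₀ → Prop) (m : Fin m₀ → ℕ) : ℕ :=
  Nat.card {φ : LexSumChains m₀ m ≃ Fin (∑ i, m i) // IsLin r0 m φ}

/-- `L₋(P₀; m₁, …, m_{m₀})`, the sign-imbalance (number of even minus number of odd
linearizations) relative to the reference ordering `b`. -/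
noncomputable def Lminus (m₀ : ℕ) (r0 : Fin m₀ → Fin m₀ → Prop) (m : Fin m₀ → ℕ)
    (b : LexSumChains m₀ m ≃ Fin (∑ i, m i)) : ℤ :=
  ∑ φ : LexSumChains m₀ m ≃ Fin (∑ i, m i),
    if IsLin r0 m φ then ((Equiv.Perm.sign (b.symm.trans φ)) : ℤ) else 0

/-- The sign of a word, `-1` to the number of its inversions. -/
def wordSign {ι : Type*} [LinearOrder ι] {N : ℕ} (w : Fin N → ι) : ℤ :=
  ∏ p, ∏ q, if p < q ∧ w q < w p then -1 else 1

/-- The sum of the signs of the words of length `N` that contain each letter `i` exactly `m i`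
times. -/
noncomputable def signedWordCount {ι : Type*} [LinearOrder ι] [Fintype ι] (N : ℕ) (m : ι → ℕ) : ℤ :=
  ∑ w : Fin N → ι, if ∀ i, (Finset.univ.filter fun p => w p = i).card = m i then wordSign w else 0

theorem wordSign_cons {ι : Type*} [LinearOrder ι] {N : ℕ} (a : ι) (w : Fin N → ι) :
    wordSign (Fin.cons a w : Fin (N + 1) → ι) =
      (∏ q, if w q < a then -1 else 1) * wordSign w := by
  simp [wordSign, Fin.prod_univ_succ]

theorem card_filter_cons_eq {ι : Type*} [DecidableEq ι] {N : ℕ} (a i : ι) (w : Fin N → ι) :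
    (Finset.univ.filter fun p => (Fin.cons a w : Fin (N + 1) → ι) p = i).card =
      (if a = i then 1 else 0) + (Finset.univ.filter fun p => w p = i).card := by
  simp only [Finset.card_filter, Fin.sum_univ_succ, Fin.cons_zero, Fin.cons_succ]

theorem sum_words_succ {ι M : Type*} [Fintype ι] [AddCommMonoid M] {N : ℕ}
    (f : (Fin (N + 1) → ι) → M) :
    ∑ w, f w = ∑ a, ∑ w : Fin N → ι, f (Fin.cons a w) := by
  rw [← (Fin.consEquiv fun _ => ι).sum_comp, Fintype.sum_prod_type]
  rfl

theorem signedWordCount_eq_sum_filter {ι : Type*} [LinearOrder ι] [Fintype ι] (N : ℕ)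
    (m : ι → ℕ) :
    signedWordCount N m = ∑ w : Fin N → ι with
      ∀ i, (Finset.univ.filter fun p => w p = i).card = m i, wordSign w :=
  (Finset.sum_filter _ _).symm

theorem signedWordCount_succ {ι : Type*} [LinearOrder ι] [Fintype ι] (N : ℕ) (m : ι → ℕ) :
    signedWordCount (N + 1) m = ∑ a, ∑ w : Fin N → ι,
      if ∀ i, (if a = i then 1 else 0) + (Finset.univ.filter fun p => w p = i).card = m i then
        wordSign (Fin.cons a w : Fin (N + 1) → ι) else 0 := by
  simp only [signedWordCount, sum_words_succ, card_filter_cons_eq]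

theorem signedWordCount_add_two {ι : Type*} [LinearOrder ι] [Fintype ι] (N : ℕ) (m : ι → ℕ) :
    signedWordCount (N + 2) m =
      ∑ a, if 2 ≤ m a then signedWordCount N (Function.update m a (m a - 2)) else 0 := by
  have key : ∀ a b : ι, ∀ w : Fin N → ι,
      wordSign (Fin.cons a (Fin.cons b w : Fin (N + 1) → ι) : Fin (N + 2) → ι) =
      (if b < a then -1 else 1) * ((∏ q, if w q < a then -1 else 1) *
        (∏ q, if w q < b then -1 else 1) * wordSign w) := by
    intro a b w
    rw [wordSign_cons, wordSign_cons, Fin.prod_univ_succ]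
    simp only [Fin.cons_zero, Fin.cons_succ]
    ring
  set T : ι → ι → ℤ := fun a b => ∑ w : Fin N → ι,
    if ∀ i, (if a = i then 1 else 0) + ((if b = i then 1 else 0) +
      (Finset.univ.filter fun p => w p = i).card) = m i then
      wordSign (Fin.cons a (Fin.cons b w : Fin (N + 1) → ι) : Fin (N + 2) → ι) else 0 with hT
  have hsum : signedWordCount (N + 2) m = ∑ a, ∑ b, T a b := by
    simp only [signedWordCount_succ, sum_words_succ, card_filter_cons_eq, hT]
  have anti : ∀ a b, a ≠ b → T a b = - T b a := by
    intro a b hab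
    simp only [hT, ← Finset.sum_neg_distrib]
    refine Finset.sum_congr rfl fun w _ => ?_
    simp only [key, add_left_comm (if a = _ then 1 else 0)]
    split_ifs with h h1 h2 h2
    · exact absurd h1 (lt_asymm h2)
    · ring
    · ring
    · exact absurd (le_antisymm (not_lt.1 h1) (not_lt.1 h2)) (by simpa using hab)
    · simp
  have diag : ∀ a, T a a =
      if 2 ≤ m a then signedWordCount N (Function.update m a (m a - 2)) else 0 := by
    intro a
    simp only [hT, key, lt_irrefl, if_false, one_mul, ← Finset.prod_mul_distrib]
    have h1 : ∀ w : Fin N → ι, (∏ q, (if w q < a then (-1 : ℤ) else 1) *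
        (if w q < a then -1 else 1)) = 1 :=
      fun w => Finset.prod_eq_one fun q _ => by split_ifs <;> rfl
    simp only [h1, one_mul]
    split_ifs with h
    · refine Finset.sum_congr rfl fun w _ => if_congr (forall_congr' fun i => ?_) rfl rfl
      by_cases hi : a = i
      · subst hi; simp; omega
      · simp [hi, Ne.symm hi]
    · refine Finset.sum_eq_zero fun w _ => if_neg fun hw => h ?_
      have := hw a
      simp at this; omega
  have hcancel : ∑ a, ∑ b, (if a = b then 0 else T a b) = 0 := by
    have : ∑ a, ∑ b, (if a = b then 0 else T a b) = - ∑ a, ∑ b, (if a = b then 0 else T a b) := by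
      conv_lhs => rw [Finset.sum_comm]
      simp only [← Finset.sum_neg_distrib]
      refine Finset.sum_congr rfl fun a _ => Finset.sum_congr rfl fun b _ => ?_
      by_cases h : a = b
      · simp [h]
      · rw [if_neg h, if_neg (Ne.symm h), anti b a (Ne.symm h)]
    omega
  have hsplit : ∀ a b, T a b = (if a = b then T a a else 0) + (if a = b then 0 else T a b) := by
    intro a b
    by_cases h : a = b
    · subst h; simp
    · simp [h]
  rw [hsum]
  calc ∑ a, ∑ b, T a b
      = ∑ a, ∑ b, ((if a = b then T a a else 0) + (if a = b then 0 else T a b)) :=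
        Finset.sum_congr rfl fun a _ => Finset.sum_congr rfl fun b _ => hsplit a b
    _ = ∑ a, T a a := by simp [Finset.sum_add_distrib, hcancel]
    _ = _ := Finset.sum_congr rfl fun a _ => diag a

theorem prod_factorial_half_mul_signedWordCount {ι : Type*} [LinearOrder ι] [Fintype ι] :
    ∀ (N : ℕ) (m : ι → ℕ), ∑ i, m i = N → (Finset.univ.filter fun i => Odd (m i)).card ≤ 1 →
      ((∏ i, (m i / 2).factorial : ℕ) : ℤ) * signedWordCount N m =
        ((∑ i, m i / 2).factorial : ℤ)
  | 0, m, hm, _ => by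
    obtain rfl : m = 0 := by
      funext i
      simpa using (Finset.sum_eq_zero_iff.1 hm) i (Finset.mem_univ i)
    simp [signedWordCount, wordSign]
  | 1, m, hm, _ => by
    obtain ⟨a, ha⟩ : ∃ a, m = Pi.single a 1 := by
      obtain ⟨a, -, ha⟩ := Finset.exists_ne_zero_of_sum_ne_zero (hm.trans_ne one_ne_zero)
      rw [Fintype.sum_eq_add_sum_compl a] at hm
      have h0 : ∑ i ∈ {a}ᶜ, m i = 0 := by omega
      refine ⟨a, funext fun i => ?_⟩
      by_cases hi : i = a
      · subst hi; simp; omega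
      · simpa [hi] using (Finset.sum_eq_zero_iff.1 h0) i (by simpa using hi)
    have hhalf : ∀ i, m i / 2 = 0 := by
      intro i
      have := Finset.single_le_sum (f := m) (fun _ _ => Nat.zero_le _) (Finset.mem_univ i)
      omega
    have hiff : ∀ b, (∀ i, (if b = i then 1 else 0) = m i) ↔ b = a := by
      intro b
      subst ha
      refine ⟨fun h => ?_, fun h i => ?_⟩
      · by_contra hb
        simpa [Pi.single_apply, hb] using h b
      · subst h; simp [Pi.single_apply, eq_comm]
    simp only [hhalf]
    rw [signedWordCount_succ]
    simp [hiff, wordSign]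
  | N + 2, m, hm, hodd => by
    have hpos : 1 ≤ ∑ i, m i / 2 := by
      have h1 : ∑ i, m i = 2 * ∑ i, m i / 2 + (Finset.univ.filter fun i => Odd (m i)).card := by
        rw [Finset.card_filter, Finset.mul_sum, ← Finset.sum_add_distrib]
        refine Finset.sum_congr rfl fun i _ => ?_
        split_ifs with h <;> rw [Nat.odd_iff] at h <;> omega
      omega
    have hterm : ∀ a, ((∏ i, (m i / 2).factorial : ℕ) : ℤ) *
        (if 2 ≤ m a then signedWordCount N (Function.update m a (m a - 2)) else 0) =
        ((m a / 2 : ℕ) : ℤ) * ((∑ i, m i / 2 - 1).factorial : ℤ) := by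
      intro a
      split_ifs with h
      · set m' := Function.update m a (m a - 2) with hm'
        have ha : m' a = m a - 2 := by simp [hm']
        have hne : ∀ i, i ≠ a → m' i = m i := fun i hi => by simp [hm', hi]
        have hsum : ∑ i, m' i = N := by
          rw [Fintype.sum_eq_add_sum_compl a] at hm ⊢
          have h1 : ∑ i ∈ {a}ᶜ, m' i = ∑ i ∈ {a}ᶜ, m i :=
            Finset.sum_congr rfl fun i hi => hne i (by simpa using hi)
          omega
        have hodd' : (Finset.univ.filter fun i => Odd (m' i)).card ≤ 1 := by
          refine (Finset.card_le_card fun i => ?_).trans hodd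
          simp only [Finset.mem_filter, Finset.mem_univ, true_and]
          by_cases hi : i = a
          · subst hi; rw [ha, Nat.odd_iff, Nat.odd_iff]; omega
          · rw [hne i hi]; exact id
        have ih := prod_factorial_half_mul_signedWordCount N m' hsum hodd'
        have hhalf : ∑ i, m' i / 2 = ∑ i, m i / 2 - 1 := by
          rw [Fintype.sum_eq_add_sum_compl a, Fintype.sum_eq_add_sum_compl a (fun i => m i / 2),
            Finset.sum_congr rfl fun i hi => by rw [hne i (by simpa using hi)], ha]
          omega
        have hprod : ∏ i, (m i / 2).factorial = m a / 2 * ∏ i, (m' i / 2).factorial := by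
          rw [Fintype.prod_eq_mul_prod_compl a, Fintype.prod_eq_mul_prod_compl a
            (fun i => (m' i / 2).factorial), ← mul_assoc]
          congr 1
          · rw [ha, show (m a - 2) / 2 = m a / 2 - 1 by omega,
              Nat.mul_factorial_pred (by omega)]
          · exact Finset.prod_congr rfl fun i hi => by rw [hne i (by simpa using hi)]
        rw [hprod, ← hhalf, ← ih]
        push_cast
        ring
      · simp [show m a / 2 = 0 by omega]
    rw [signedWordCount_add_two, Finset.mul_sum, Finset.sum_congr rfl fun a _ => hterm a,
      ← Finset.sum_mul, ← Nat.cast_sum, ← Nat.cast_mul, Nat.mul_factorial_pred (by omega)]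

theorem lexRel_antichain_iff {m₀ : ℕ} {r0 : Fin m₀ → Fin m₀ → Prop}
    (hantichain : ∀ i j : Fin m₀, r0 i j ↔ i = j) {m : Fin m₀ → ℕ} (x y : LexSumChains m₀ m) :
    lexRel r0 m x y ↔ x.1 = y.1 ∧ (x.2 : ℕ) ≤ (y.2 : ℕ) := by
  simp only [lexRel, hantichain]
  tauto

theorem isLin_antichain_iff {m₀ : ℕ} {r0 : Fin m₀ → Fin m₀ → Prop}
    (hantichain : ∀ i j : Fin m₀, r0 i j ↔ i = j) {m : Fin m₀ → ℕ}
    (φ : LexSumChains m₀ m ≃ Fin (∑ i, m i)) :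
    IsLin r0 m φ ↔ ∀ i, StrictMono fun j : Fin (m i) => φ ⟨i, j⟩ := by
  simp only [IsLin, lexRel_antichain_iff hantichain]
  constructor
  · intro h i
    have hmono : Monotone fun j : Fin (m i) => φ ⟨i, j⟩ := fun j k hjk => h _ _ ⟨rfl, hjk⟩
    exact hmono.strictMono_of_injective (φ.injective.comp sigma_mk_injective)
  · rintro h ⟨i, j⟩ ⟨i', k⟩ ⟨hi, hjk⟩
    obtain rfl : i = i' := hi
    exact (h i).monotone hjk

/-- The word recording, position by position, which chain the elements of the ordering `φ` come
from. -/
def chainWord {m₀ : ℕ} {m : Fin m₀ → ℕ} (φ : LexSumChains m₀ m ≃ Fin (∑ i, m i)) :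
    Fin (∑ i, m i) → Fin m₀ :=
  fun p => (φ.symm p).1

theorem chainWord_apply {m₀ : ℕ} {m : Fin m₀ → ℕ} (φ : LexSumChains m₀ m ≃ Fin (∑ i, m i))
    (x : LexSumChains m₀ m) : chainWord φ (φ x) = x.1 := by
  rw [chainWord, Equiv.symm_apply_apply]

theorem card_filter_chainWord {m₀ : ℕ} {m : Fin m₀ → ℕ}
    (φ : LexSumChains m₀ m ≃ Fin (∑ i, m i)) (i : Fin m₀) :
    (Finset.univ.filter fun p => chainWord φ p = i).card = m i := by
  have h : (Finset.univ.filter fun p => chainWord φ p = i) =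
      Finset.univ.image fun j : Fin (m i) => φ ⟨i, j⟩ := by
    ext p
    obtain ⟨⟨i', j⟩, rfl⟩ := φ.surjective p
    simp only [Finset.mem_filter, Finset.mem_univ, true_and, Finset.mem_image, chainWord_apply,
      φ.injective.eq_iff]
    constructor
    · rintro rfl
      exact ⟨j, rfl⟩
    · rintro ⟨k, hk⟩
      exact (congrArg Sigma.fst hk).symm
  have hinj : Function.Injective fun j : Fin (m i) => φ ⟨i, j⟩ :=
    φ.injective.comp sigma_mk_injective
  rw [h, Finset.card_image_of_injective _ hinj, Finset.card_univ, Fintype.card_fin]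

theorem chainWord_injOn {m₀ : ℕ} {m : Fin m₀ → ℕ}
    {φ ψ : LexSumChains m₀ m ≃ Fin (∑ i, m i)}
    (hφ : ∀ i, StrictMono fun j : Fin (m i) => φ ⟨i, j⟩)
    (hψ : ∀ i, StrictMono fun j : Fin (m i) => ψ ⟨i, j⟩) (h : chainWord φ = chainWord ψ) :
    φ = ψ := by
  ext1 ⟨i, j⟩
  have h1 := Finset.orderEmbOfFin_unique (card_filter_chainWord φ i)
    (fun j => by simp [chainWord_apply]) (hφ i)
  have h2 := Finset.orderEmbOfFin_unique (card_filter_chainWord φ i)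
    (fun j => by rw [h]; simp [chainWord_apply]) (hψ i)
  exact congrFun (h1.trans h2.symm) j

theorem exists_chainWord_eq {m₀ : ℕ} {m : Fin m₀ → ℕ} (w : Fin (∑ i, m i) → Fin m₀)
    (hw : ∀ i, (Finset.univ.filter fun p => w p = i).card = m i) :
    ∃ φ : LexSumChains m₀ m ≃ Fin (∑ i, m i),
      (∀ i, StrictMono fun j : Fin (m i) => φ ⟨i, j⟩) ∧ chainWord φ = w := by
  set f : LexSumChains m₀ m → Fin (∑ i, m i) :=
    fun x => (Finset.univ.filter fun p => w p = x.1).orderEmbOfFin (hw x.1) x.2 with hf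
  have hwf : ∀ x, w (f x) = x.1 := fun x =>
    (Finset.mem_filter.1 (Finset.orderEmbOfFin_mem _ (hw x.1) x.2)).2
  have hinj : Function.Injective f := by
    rintro ⟨i, j⟩ ⟨i', k⟩ hjk
    obtain rfl : i = i' := by simpa [hwf] using congrArg w hjk
    exact congrArg _ ((Finset.orderEmbOfFin _ (hw i)).injective hjk)
  have hbij : Function.Bijective f :=
    (Fintype.bijective_iff_injective_and_card f).2 ⟨hinj, by simp⟩
  refine ⟨Equiv.ofBijective f hbij, fun i => (Finset.orderEmbOfFin _ (hw i)).strictMono, ?_⟩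
  funext p
  obtain ⟨x, rfl⟩ := hbij.2 p
  rw [chainWord, Equiv.ofBijective_symm_apply_apply, hwf]

theorem sign_eq_wordSign {m₀ : ℕ} {m : Fin m₀ → ℕ} {b φ : LexSumChains m₀ m ≃ Fin (∑ i, m i)}
    (hb : IsRef m b) (hφ : ∀ i, StrictMono fun j : Fin (m i) => φ ⟨i, j⟩) :
    (Equiv.Perm.sign (b.symm.trans φ) : ℤ) = wordSign (chainWord φ) := by
  have hinv : ∀ p q, p < q →
      (b (φ.symm p) < b (φ.symm q) ↔ ¬ chainWord φ q < chainWord φ p) := by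
    intro p q hpq
    have hne : b (φ.symm p) ≠ b (φ.symm q) := fun h => hpq.ne (by simpa using h)
    constructor
    · exact fun h h' => (hb _ _ (Or.inl h')).not_gt h
    · intro h
      refine lt_of_le_of_ne (hb _ _ ?_) hne
      rcases (not_lt.1 h).lt_or_eq with h' | h'
      · exact Or.inl h'
      · refine Or.inr ⟨h', ?_⟩
        obtain ⟨⟨i, j⟩, rfl⟩ := φ.surjective p
        obtain ⟨⟨i', k⟩, rfl⟩ := φ.surjective q
        obtain rfl : i = i' := by simpa only [chainWord_apply] using h'
        rw [Equiv.symm_apply_apply, Equiv.symm_apply_apply]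
        exact ((hφ i).lt_iff_lt.1 hpq).le
  rw [← Equiv.Perm.sign_symm, Equiv.Perm.sign_eq_prod_prod_Ioi, wordSign, Units.coe_prod]
  refine Finset.prod_congr rfl fun p _ => ?_
  rw [Units.coe_prod, ← Finset.filter_lt_eq_Ioi, Finset.prod_filter]
  refine Finset.prod_congr rfl fun q _ => ?_
  by_cases hpq : p < q
  · have := hinv p q hpq
    simp only [Equiv.symm_trans_apply, Equiv.symm_symm, hpq, this, true_and, if_true]
    split_ifs <;> simp_all
  · simp [hpq]

theorem Lminus_antichain_eq_signedWordCount {m₀ : ℕ} {r0 : Fin m₀ → Fin m₀ → Prop}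
    (hantichain : ∀ i j : Fin m₀, r0 i j ↔ i = j) {m : Fin m₀ → ℕ}
    {b : LexSumChains m₀ m ≃ Fin (∑ i, m i)} (hb : IsRef m b) :
    Lminus m₀ r0 m b = signedWordCount (∑ i, m i) m := by
  rw [Lminus, signedWordCount_eq_sum_filter, ← Finset.sum_filter]
  refine Finset.sum_bij (fun φ _ => chainWord φ) ?_ ?_ ?_ ?_
  · intro φ _
    simpa using card_filter_chainWord φ
  · intro φ hφ ψ hψ h
    simp only [Finset.mem_filter, Finset.mem_univ, true_and, isLin_antichain_iff hantichain]
      at hφ hψ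
    exact chainWord_injOn hφ hψ h
  · intro w hw
    obtain ⟨φ, hφ, h⟩ := exists_chainWord_eq w (by simpa using hw)
    exact ⟨φ, by simpa [isLin_antichain_iff hantichain] using hφ, h⟩
  · intro φ hφ
    simp only [Finset.mem_filter, Finset.mem_univ, true_and, isLin_antichain_iff hantichain] at hφ
    exact sign_eq_wordSign hb hφ

/-- If `P₀` is an antichain and at most one of the `mᵢ` is odd, then the
sign-imbalance of the lexicographic sum over `P₀` of disjoint chains of cardinalities
`m₁, …, m_{m₀}` is the multinomial coefficient `(∑ ⌊mᵢ/2⌋)! / ∏ ⌊mᵢ/2⌋!`. -/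
theorem lexSum_over_antichain_signImbalance_of_atMostOneOdd (m₀ : ℕ)
    (r0 : Fin m₀ → Fin m₀ → Prop) (hantichain : ∀ i j : Fin m₀, r0 i j ↔ i = j)
    (m : Fin m₀ → ℕ) (hodd : (Finset.univ.filter fun i => Odd (m i)).card ≤ 1) :
    ∀ b : LexSumChains m₀ m ≃ Fin (∑ i, m i), IsRef m b →
      Lminus m₀ r0 m b = (Nat.multinomial Finset.univ (fun i => m i / 2) : ℤ) := by
  intro b hb
  have h := prod_factorial_half_mul_signedWordCount _ m rfl hodd
  rw [← Nat.multinomial_spec, Nat.cast_mul] at h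
  rw [Lminus_antichain_eq_signedWordCount hantichain hb]
  refine mul_left_cancel₀ ?_ h
  exact_mod_cast Finset.prod_ne_zero_iff.2 fun i _ => Nat.factorial_ne_zero _
end

section
/- Let P₀ be a finite poset with elements x₁,…,x_{m₀}, fix an index i₀ ∈ {1,…,m₀} and nonnegative values mᵢ for each i ≠ i₀. Then there exist two polynomials f₀ and f₁ such that L₋(P₀; m₁,…,m_{m₀}) = f₀(m_{i₀}) for all even m_{i₀} ≥ 0 and L₋(P₀; m₁,…,m_{m₀}) = f₁(m_{i₀}) for all odd m_{i₀} ≥ 0, and each of f₀, f₁ has degree at most ⌊(∑ mᵢ)/2⌋, the sum being over those i ≠ i₀ such that xᵢ is incomparable with x_{i₀} in P₀. -/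
open scoped Classical

/-- The sum of `∏ j, (-1) ^ p j` over weakly increasing sequences `p` of length `t` with values in
`[lo, lo + k)`. -/
noncomputable def signedMonotoneSum (k lo t : ℕ) : ℤ :=
  ∑ p ∈ (Fintype.piFinset fun _ : Fin t => Finset.Ico lo (lo + k)).filter Monotone,
    ∏ j, (-1 : ℤ) ^ p j

theorem signedMonotoneSum_zero_right (k lo : ℕ) : signedMonotoneSum k lo 0 = 1 := by
  unfold signedMonotoneSum
  rw [Finset.sum_eq_single_of_mem (fun i => i.elim0)]
  · simp
  · simp only [Finset.mem_filter, Fintype.mem_piFinset]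
    exact ⟨fun i => i.elim0, fun i => i.elim0⟩
  · intro b _ hb
    exact absurd (Subsingleton.elim _ _) hb

theorem signedMonotoneSum_zero_left (lo t : ℕ) : signedMonotoneSum 0 lo (t + 1) = 0 := by
  unfold signedMonotoneSum
  apply Finset.sum_eq_zero
  intro p hp
  have := Fintype.mem_piFinset.1 (Finset.mem_filter.1 hp).1 0
  simp at this

theorem monotone_fin_cons_iff {t : ℕ} (a : ℕ) (p : Fin t → ℕ) :
    Monotone (Fin.cons a p : Fin (t + 1) → ℕ) ↔ (∀ j, a ≤ p j) ∧ Monotone p := by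
  constructor
  · intro h
    refine ⟨fun j => ?_, fun i j hij => ?_⟩
    · simpa using h (Fin.zero_le j.succ)
    · simpa using h (Fin.succ_le_succ_iff.2 hij)
  · rintro ⟨h1, h2⟩ i j hij
    induction i using Fin.cases with
    | zero =>
      induction j using Fin.cases with
      | zero => exact le_rfl
      | succ j => simpa using h1 j
    | succ i =>
      induction j using Fin.cases with
      | zero => simp at hij
      | succ j => simpa using h2 (Fin.succ_le_succ_iff.1 hij)

theorem signedMonotoneSum_succ (k lo t : ℕ) :
    signedMonotoneSum (k + 1) lo (t + 1) =
      (-1) ^ lo * signedMonotoneSum (k + 1) lo t + signedMonotoneSum k (lo + 1) (t + 1) := by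
  unfold signedMonotoneSum
  rw [← Finset.sum_filter_add_sum_filter_not _ (fun p : Fin (t + 1) → ℕ => p 0 = lo)]
  congr 1
  · rw [Finset.mul_sum]
    refine Finset.sum_nbij' (fun p => Fin.tail p) (fun p => Fin.cons lo p) ?_ ?_ ?_ ?_ ?_
    · intro p hp
      simp only [Finset.mem_filter, Fintype.mem_piFinset] at hp ⊢
      exact ⟨fun j => hp.1.1 j.succ, fun i j hij => hp.1.2 (Fin.succ_le_succ_iff.2 hij)⟩
    · intro p hp
      simp only [Finset.mem_filter, Fintype.mem_piFinset] at hp ⊢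
      refine ⟨⟨fun j => ?_, ?_⟩, Fin.cons_zero _ _⟩
      · induction j using Fin.cases with
        | zero => simp
        | succ j => simpa using hp.1 j
      · exact (monotone_fin_cons_iff _ _).2 ⟨fun j => (Finset.mem_Ico.1 (hp.1 j)).1, hp.2⟩
    · intro p hp
      have h0 := (Finset.mem_filter.1 hp).2
      rw [← h0]
      exact Fin.cons_self_tail p
    · intro p _
      exact Fin.tail_cons _ _
    · intro p hp
      have h0 := (Finset.mem_filter.1 hp).2
      rw [Fin.prod_univ_succ, h0]
      rfl
  · refine Finset.sum_congr ?_ fun _ _ => rfl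
    ext p
    simp only [Finset.mem_filter, Fintype.mem_piFinset, Finset.mem_Ico]
    constructor
    · rintro ⟨⟨h, hm⟩, h0⟩
      refine ⟨fun j => ?_, hm⟩
      have := h j
      have := h 0
      have := hm (Fin.zero_le j)
      omega
    · rintro ⟨h, hm⟩
      refine ⟨⟨fun j => ?_, hm⟩, ?_⟩
      · have := h j
        omega
      · have := h 0
        omega

theorem signedMonotoneSum_odd_of_even (c : ℕ)
    (h : ∀ lo s, signedMonotoneSum (2 * c) lo (2 * (s + 1)) = ((s + c).choose (s + 1) : ℕ) ∧
      signedMonotoneSum (2 * c) lo (2 * s + 1) = 0) (lo s : ℕ) :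
    signedMonotoneSum (2 * c + 1) lo (2 * s) = ((s + c).choose s : ℕ) ∧
      signedMonotoneSum (2 * c + 1) lo (2 * s + 1) = (-1) ^ lo * ((s + c).choose s : ℕ) := by
  have odd : ∀ s, signedMonotoneSum (2 * c + 1) lo (2 * s) = ((s + c).choose s : ℕ) →
      signedMonotoneSum (2 * c + 1) lo (2 * s + 1) = (-1) ^ lo * ((s + c).choose s : ℕ) := by
    intro s hs
    rw [signedMonotoneSum_succ, hs, (h (lo + 1) s).2, add_zero]
  induction s with
  | zero =>
    have h0 : signedMonotoneSum (2 * c + 1) lo (2 * 0) = ((0 + c).choose 0 : ℕ) := by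
      simpa using signedMonotoneSum_zero_right _ _
    exact ⟨h0, odd 0 h0⟩
  | succ s ih =>
    have h1 : signedMonotoneSum (2 * c + 1) lo (2 * (s + 1)) = ((s + 1 + c).choose (s + 1) : ℕ) := by
      have := (h (lo + 1) s).1
      rw [show 2 * (s + 1) = 2 * s + 1 + 1 by ring] at this ⊢
      rw [signedMonotoneSum_succ, ih.2, this, ← mul_assoc, ← mul_pow,
        show s + 1 + c = (s + c) + 1 by ring, Nat.choose_succ_succ]
      simp
    exact ⟨h1, odd _ h1⟩

theorem signedMonotoneSum_even_of_odd (c : ℕ)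
    (h : ∀ lo s, signedMonotoneSum (2 * c + 1) lo (2 * s) = ((s + c).choose s : ℕ) ∧
      signedMonotoneSum (2 * c + 1) lo (2 * s + 1) = (-1) ^ lo * ((s + c).choose s : ℕ))
    (lo s : ℕ) :
    signedMonotoneSum (2 * c + 2) lo (2 * s) = ((s + c).choose s : ℕ) ∧
      signedMonotoneSum (2 * c + 2) lo (2 * s + 1) = 0 := by
  have odd : ∀ s, signedMonotoneSum (2 * c + 2) lo (2 * s) = ((s + c).choose s : ℕ) →
      signedMonotoneSum (2 * c + 2) lo (2 * s + 1) = 0 := by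
    intro s hs
    rw [signedMonotoneSum_succ, hs, (h (lo + 1) s).2]
    ring
  induction s with
  | zero =>
    have h0 : signedMonotoneSum (2 * c + 2) lo (2 * 0) = ((0 + c).choose 0 : ℕ) := by
      simpa using signedMonotoneSum_zero_right _ _
    exact ⟨h0, odd 0 h0⟩
  | succ s ih =>
    have h1 : signedMonotoneSum (2 * c + 2) lo (2 * (s + 1)) = ((s + 1 + c).choose (s + 1) : ℕ) := by
      have := (h (lo + 1) (s + 1)).1
      rw [show 2 * (s + 1) = 2 * s + 1 + 1 by ring] at this ⊢
      rw [signedMonotoneSum_succ, ih.2, this]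
      ring
    exact ⟨h1, odd _ h1⟩

theorem signedMonotoneSum_odd (c lo s : ℕ) :
    signedMonotoneSum (2 * c + 1) lo (2 * s) = ((s + c).choose s : ℕ) ∧
      signedMonotoneSum (2 * c + 1) lo (2 * s + 1) = (-1) ^ lo * ((s + c).choose s : ℕ) := by
  induction c generalizing lo s with
  | zero =>
    refine signedMonotoneSum_odd_of_even 0 (fun lo s => ⟨?_, ?_⟩) lo s
    · rw [Nat.choose_eq_zero_of_lt (by omega), show 2 * (s + 1) = 2 * s + 1 + 1 by ring]
      simpa using signedMonotoneSum_zero_left _ _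
    · exact signedMonotoneSum_zero_left _ _
  | succ c ih =>
    refine signedMonotoneSum_odd_of_even (c + 1) (fun lo s => ⟨?_, ?_⟩) lo s
    · have := (signedMonotoneSum_even_of_odd c ih lo (s + 1)).1
      rwa [show s + 1 + c = s + (c + 1) by ring] at this
    · exact (signedMonotoneSum_even_of_odd c ih lo s).2

theorem exists_polynomial_choose (c : ℕ) :
    ∃ g : Polynomial ℚ, g.natDegree ≤ c ∧ ∀ s : ℕ, g.eval (s : ℚ) = ((s + c).choose s : ℕ) :=
  ⟨Polynomial.preHilbertPoly ℚ c 0, (Polynomial.natDegree_preHilbertPoly ℚ c 0).le, fun s => by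
    rw [Polynomial.preHilbertPoly_eq_choose_sub_add ℚ c (Nat.zero_le s), Nat.sub_zero,
      Nat.choose_symm_add]⟩

theorem exists_polynomial_signedMonotoneSum (k lo : ℕ) :
    ∃ g₀ g₁ : Polynomial ℚ, g₀.natDegree ≤ k / 2 ∧ g₁.natDegree ≤ k / 2 ∧
      ∀ t : ℕ, (Even t → (signedMonotoneSum (k + 1) lo t : ℚ) = g₀.eval (t : ℚ)) ∧
        (Odd t → (signedMonotoneSum (k + 1) lo t : ℚ) = g₁.eval (t : ℚ)) := by
  have half : ∀ (g : Polynomial ℚ) (c : ℕ) (a : ℚ), g.natDegree ≤ c →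
      (g.comp (Polynomial.C (1 / 2) * Polynomial.X + Polynomial.C a)).natDegree ≤ c := by
    intro g c a hg
    refine Polynomial.natDegree_comp_le.trans ?_
    calc _ ≤ g.natDegree * 1 := Nat.mul_le_mul_left _ Polynomial.natDegree_linear_le
      _ ≤ c := by simpa using hg
  obtain ⟨c, hc | hc⟩ : ∃ c, k = 2 * c ∨ k = 2 * c + 1 := ⟨k / 2, by omega⟩
  · subst hc
    obtain ⟨g, hg, hgs⟩ := exists_polynomial_choose c
    rw [show 2 * c / 2 = c by omega]
    refine ⟨g.comp (Polynomial.C (1 / 2) * Polynomial.X + Polynomial.C 0),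
      Polynomial.C ((-1) ^ lo) *
        g.comp (Polynomial.C (1 / 2) * Polynomial.X + Polynomial.C (-(1 / 2))), half _ _ _ hg,
      (Polynomial.natDegree_C_mul_le _ _).trans (half _ _ _ hg), fun t => ⟨?_, ?_⟩⟩
    · rintro ⟨s, rfl⟩
      rw [← two_mul, (signedMonotoneSum_odd c lo s).1]
      simp [hgs]
    · rintro ⟨s, rfl⟩
      rw [(signedMonotoneSum_odd c lo s).2]
      have : (2⁻¹ * (2 * (s : ℚ) + 1) + -2⁻¹) = s := by ring
      simp [hgs, this]
  · subst hc
    obtain ⟨g, hg, hgs⟩ := exists_polynomial_choose c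
    rw [show (2 * c + 1) / 2 = c by omega]
    refine ⟨g.comp (Polynomial.C (1 / 2) * Polynomial.X + Polynomial.C 0), 0, half _ _ _ hg,
      by simp, fun t => ⟨?_, ?_⟩⟩
    · rintro ⟨s, rfl⟩
      rw [← two_mul, (signedMonotoneSum_even_of_odd c (signedMonotoneSum_odd c) lo s).1]
      simp [hgs]
    · rintro ⟨s, rfl⟩
      rw [(signedMonotoneSum_even_of_odd c (signedMonotoneSum_odd c) lo s).2]
      simp

theorem exists_equiv_fin_lt_iff {α K : Type*} [Fintype α] [LinearOrder K] {n : ℕ}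
    (hn : Fintype.card α = n) (key : α → K) (hkey : Function.Injective key) :
    ∃ φ : α ≃ Fin n, ∀ x y, φ x < φ y ↔ key x < key y := by
  let _ : LinearOrder α := LinearOrder.lift' key hkey
  exact ⟨(Fintype.orderIsoFinOfCardEq α hn).symm.toEquiv,
    fun x y => (Fintype.orderIsoFinOfCardEq α hn).symm.lt_iff_lt⟩

theorem equiv_fin_ext_of_lt_iff {α : Type*} {n : ℕ} {φ φ' : α ≃ Fin n}
    (h : ∀ x y, φ x < φ y ↔ φ' x < φ' y) : φ = φ' := by
  have hmono : StrictMono (φ.symm.trans φ') := by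
    intro a b hab
    have := (h (φ.symm a) (φ.symm b)).1 (by simpa using hab)
    simpa using this
  have hid : (φ.symm.trans φ' : Fin n → Fin n) = id := by
    let f : Fin n ≃o Fin n := StrictMono.orderIsoOfSurjective _ hmono (Equiv.surjective _)
    have : f = OrderIso.refl _ := Subsingleton.elim _ _
    exact congrArg (fun g : Fin n ≃o Fin n => (g : Fin n → Fin n)) this
  ext x
  have := congrFun hid (φ x)
  simp only [Equiv.trans_apply, Equiv.symm_apply_apply, id] at this
  rw [this]

theorem card_filter_equiv_fin_lt {Q : Type*} [Fintype Q] {N : ℕ} (ψ : Q ≃ Fin N) {v : ℕ}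
    (hv : v ≤ N) : (Finset.univ.filter fun q => (ψ q : ℕ) < v).card = v := by
  have : (Finset.univ.filter fun q => (ψ q : ℕ) < v).card =
      (Finset.univ.filter fun a : Fin N => (a : ℕ) < v).card :=
    Finset.card_bijective ψ ψ.bijective (by simp)
  rw [this, Fin.card_filter_val_lt, min_eq_right hv]

/-- The total order `φ` on `Q ⊕ Fin t` is obtained from the total order `ψ` on `Q` by inserting
the `j`-th element of the chain `Fin t` right after the first `p j` elements of `Q`. -/
structure IsInsertion {Q : Type*} {n N t : ℕ} (φ : Q ⊕ Fin t ≃ Fin n) (ψ : Q ≃ Fin N)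
    (p : Fin t → ℕ) : Prop where
  left_lt_left : ∀ q q', φ (.inl q) < φ (.inl q') ↔ ψ q < ψ q'
  left_lt_right : ∀ q j, φ (.inl q) < φ (.inr j) ↔ (ψ q : ℕ) < p j
  right_lt_right : ∀ i j, φ (.inr i) < φ (.inr j) ↔ i < j
  le_card : ∀ j, p j ≤ N
  monotone : Monotone p

theorem IsInsertion.right_lt_left {Q : Type*} {n N t : ℕ} {φ : Q ⊕ Fin t ≃ Fin n} {ψ : Q ≃ Fin N}
    {p : Fin t → ℕ} (h : IsInsertion φ ψ p) (q : Q) (j : Fin t) :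
    φ (.inr j) < φ (.inl q) ↔ p j ≤ (ψ q : ℕ) := by
  have hne : φ (.inr j) ≠ φ (.inl q) := φ.injective.ne (by simp)
  rw [← not_lt, ← h.left_lt_right, not_lt]
  exact ⟨le_of_lt, fun h => lt_of_le_of_ne h hne⟩

theorem IsInsertion.eq_card {Q : Type*} [Fintype Q] {n N t : ℕ} {φ : Q ⊕ Fin t ≃ Fin n}
    {ψ : Q ≃ Fin N} {p : Fin t → ℕ} (h : IsInsertion φ ψ p) (j : Fin t) :
    p j = (Finset.univ.filter fun q => φ (.inl q) < φ (.inr j)).card := by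
  simp_rw [h.left_lt_right]
  exact (card_filter_equiv_fin_lt ψ (h.le_card j)).symm

theorem IsInsertion.equiv_unique {Q : Type*} {n N t : ℕ} {φ φ' : Q ⊕ Fin t ≃ Fin n}
    {ψ ψ' : Q ≃ Fin N} {p p' : Fin t → ℕ} (h : IsInsertion φ ψ p) (h' : IsInsertion φ' ψ' p')
    (hψ : ψ = ψ') (hp : p = p') : φ = φ' := by
  subst hψ hp
  apply equiv_fin_ext_of_lt_iff
  rintro (q | i) (q' | j)
  · rw [h.left_lt_left, h'.left_lt_left]
  · rw [h.left_lt_right, h'.left_lt_right]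
  · rw [h.right_lt_left, h'.right_lt_left]
  · rw [h.right_lt_right, h'.right_lt_right]

theorem exists_isInsertion_of_strictMono {Q : Type*} [Fintype Q] {n N t : ℕ}
    (hN : Fintype.card Q = N) (φ : Q ⊕ Fin t ≃ Fin n)
    (hφ : ∀ i j, i < j → φ (.inr i) < φ (.inr j)) : ∃ ψ p, IsInsertion φ (ψ : Q ≃ Fin N) p := by
  obtain ⟨ψ, hψ⟩ := exists_equiv_fin_lt_iff hN (fun q => φ (.inl q))
    (φ.injective.comp Sum.inl_injective)
  have hmono : StrictMono fun j => φ (.inr j) := fun i j => hφ i j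
  refine ⟨ψ, fun j => (Finset.univ.filter fun q => φ (.inl q) < φ (.inr j)).card,
    fun q q' => (hψ q q').symm, fun q j => ?_, fun i j => hmono.lt_iff_lt, fun j => ?_,
    fun i j hij => ?_⟩
  · constructor
    · intro h
      have h1 := card_filter_equiv_fin_lt ψ (Nat.succ_le_of_lt (ψ q).2)
      rw [← Nat.succ_le_iff, ← h1]
      refine Finset.card_le_card fun q' hq' => ?_
      simp only [Finset.mem_filter, Finset.mem_univ, true_and] at hq' ⊢
      have h2 : ψ q' ≤ ψ q := by
        rw [Fin.le_def]
        omega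
      refine lt_of_le_of_lt (not_lt.1 fun h3 => ?_) h
      exact absurd ((hψ _ _).2 h3) (not_lt.2 h2)
    · intro h
      by_contra hc
      refine absurd h (not_lt.2 ?_)
      conv_rhs => rw [← card_filter_equiv_fin_lt ψ (ψ q).2.le]
      refine Finset.card_le_card fun q' hq' => ?_
      simp only [Finset.mem_filter, Finset.mem_univ, true_and] at hq' ⊢
      exact (hψ _ _).2 (lt_of_lt_of_le hq' (not_lt.1 hc))
  · exact (Finset.card_le_univ _).trans hN.le
  · refine Finset.card_le_card fun q' hq' => ?_
    simp only [Finset.mem_filter, Finset.mem_univ, true_and] at hq' ⊢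
    exact lt_of_lt_of_le hq' (hmono.monotone hij)

theorem exists_isInsertion_of_monotone {Q : Type*} [Fintype Q] {n N t : ℕ}
    (hn : Fintype.card (Q ⊕ Fin t) = n) (ψ : Q ≃ Fin N) (p : Fin t → ℕ) (hp : Monotone p)
    (hpN : ∀ j, p j ≤ N) : ∃ φ : Q ⊕ Fin t ≃ Fin n, IsInsertion φ ψ p := by
  let key : Q ⊕ Fin t → ℕ ×ₗ ℕ :=
    Sum.elim (fun q => toLex (2 * (ψ q : ℕ) + 1, 0)) fun j => toLex (2 * p j, (j : ℕ))
  have hkey : Function.Injective key := by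
    rintro (q | i) (q' | j) h
    · have : (2 * (ψ q : ℕ) + 1, 0) = (2 * (ψ q' : ℕ) + 1, 0) := toLex.injective h
      simp only [Prod.mk.injEq] at this
      exact congrArg _ (ψ.injective (Fin.ext (by omega)))
    · have : (2 * (ψ q : ℕ) + 1, 0) = (2 * p j, (j : ℕ)) := toLex.injective h
      simp only [Prod.mk.injEq] at this
      omega
    · have : (2 * p i, (i : ℕ)) = (2 * (ψ q' : ℕ) + 1, 0) := toLex.injective h
      simp only [Prod.mk.injEq] at this
      omega
    · have : (2 * p i, (i : ℕ)) = (2 * p j, (j : ℕ)) := toLex.injective h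
      simp only [Prod.mk.injEq] at this
      exact congrArg _ (Fin.ext this.2)
  obtain ⟨φ, hφ⟩ := exists_equiv_fin_lt_iff hn key hkey
  refine ⟨φ, fun q q' => ?_, fun q j => ?_, fun i j => ?_, hpN, hp⟩
  · rw [hφ, Prod.Lex.lt_iff, Fin.lt_def]
    simp only [key, Sum.elim_inl, ofLex_toLex]
    omega
  · rw [hφ, Prod.Lex.lt_iff]
    simp only [key, Sum.elim_inl, Sum.elim_inr, ofLex_toLex]
    omega
  · rw [hφ, Prod.Lex.lt_iff, Fin.lt_def]
    simp only [key, Sum.elim_inr, ofLex_toLex]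
    rcases lt_trichotomy i j with h | h | h
    · have := hp h.le
      rw [Fin.lt_def] at h
      omega
    · subst h
      omega
    · have := hp h.le
      rw [Fin.lt_def] at h
      omega

theorem sum_equiv_eq_sum_insertions {Q : Type*} [Fintype Q] [DecidableEq Q] {n N t : ℕ}
    (hN : Fintype.card Q = N) (hn : Fintype.card (Q ⊕ Fin t) = n)
    (F : (Q ⊕ Fin t ≃ Fin n) → ℤ) (G : (Q ≃ Fin N) → (Fin t → ℕ) → ℤ)
    (hFG : ∀ φ ψ p, IsInsertion φ ψ p → F φ = G ψ p)
    (hF : ∀ φ, (¬ ∀ i j, i < j → φ (.inr i) < φ (.inr j)) → F φ = 0) :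
    ∑ φ, F φ = ∑ ψ, ∑ p ∈ (Fintype.piFinset fun _ : Fin t => Finset.range (N + 1)).filter Monotone,
      G ψ p := by
  rw [Finset.sum_sigma', ← Finset.sum_filter_of_ne
    (p := fun φ : Q ⊕ Fin t ≃ Fin n => ∀ i j, i < j → φ (.inr i) < φ (.inr j))
    fun φ _ h => by_contra fun hc => h (hF φ hc)]
  refine Finset.sum_bij
    (fun φ hφ => ⟨(exists_isInsertion_of_strictMono hN φ (Finset.mem_filter.1 hφ).2).choose,
      (exists_isInsertion_of_strictMono hN φ (Finset.mem_filter.1 hφ).2).choose_spec.choose⟩)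
    ?_ ?_ ?_ ?_
  · intro φ hφ
    have h := (exists_isInsertion_of_strictMono hN φ
      (Finset.mem_filter.1 hφ).2).choose_spec.choose_spec
    simp only [Finset.mem_sigma, Finset.mem_univ, Finset.mem_filter, Fintype.mem_piFinset,
      Finset.mem_range, true_and]
    exact ⟨fun j => Nat.lt_succ_of_le (h.le_card j), h.monotone⟩
  · intro φ hφ φ' hφ' heq
    have h := (exists_isInsertion_of_strictMono hN φ
      (Finset.mem_filter.1 hφ).2).choose_spec.choose_spec
    have h' := (exists_isInsertion_of_strictMono hN φ'
      (Finset.mem_filter.1 hφ').2).choose_spec.choose_spec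
    simp only [Sigma.mk.injEq, heq_eq_eq] at heq
    exact h.equiv_unique h' heq.1 heq.2
  · rintro ⟨ψ, p⟩ hp
    simp only [Finset.mem_sigma, Finset.mem_univ, Finset.mem_filter, Fintype.mem_piFinset,
      Finset.mem_range, true_and] at hp
    obtain ⟨φ, h⟩ := exists_isInsertion_of_monotone hn ψ p hp.2
      fun j => Nat.le_of_lt_succ (hp.1 j)
    have hφ : φ ∈ Finset.univ.filter
        fun φ : Q ⊕ Fin t ≃ Fin n => ∀ i j, i < j → φ (.inr i) < φ (.inr j) :=
      Finset.mem_filter.2 ⟨Finset.mem_univ _, fun i j => (h.right_lt_right i j).2⟩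
    refine ⟨φ, hφ, ?_⟩
    have h' := (exists_isInsertion_of_strictMono hN φ
      (Finset.mem_filter.1 hφ).2).choose_spec.choose_spec
    refine Sigma.ext ?_ (heq_of_eq (funext fun j => ?_))
    · exact equiv_fin_ext_of_lt_iff fun q q' => by
        rw [← h.left_lt_left, ← h'.left_lt_left]
    · exact (h'.eq_card j).trans (h.eq_card j).symm
  · intro φ hφ
    exact hFG _ _ _ (exists_isInsertion_of_strictMono hN φ
      (Finset.mem_filter.1 hφ).2).choose_spec.choose_spec

theorem sign_symm_trans_eq_prod {α : Type*} [Fintype α] {n : ℕ} (b φ : α ≃ Fin n) :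
    ((Equiv.Perm.sign (b.symm.trans φ)) : ℤ) =
      ∏ x, ∏ y, if b x < b y ∧ φ y < φ x then -1 else 1 := by
  rw [Equiv.Perm.sign_eq_prod_prod_Ioi, Units.coe_prod, ← Equiv.prod_comp b]
  refine Finset.prod_congr rfl fun x _ => ?_
  rw [Units.coe_prod, ← Finset.filter_lt_eq_Ioi, Finset.prod_filter, ← Equiv.prod_comp b]
  refine Finset.prod_congr rfl fun y _ => ?_
  simp only [Equiv.trans_apply, Equiv.symm_apply_apply]
  by_cases hb : b x < b y
  · have hne : φ x ≠ φ y := φ.injective.ne fun h => by simp [h] at hb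
    rcases lt_or_gt_of_ne hne with h | h
    · simp [hb, h, h.not_gt]
    · simp [hb, h, h.not_gt]
  · simp [hb]

theorem IsInsertion.sign_eq {Q : Type*} [Fintype Q] {n N t : ℕ} {φ : Q ⊕ Fin t ≃ Fin n}
    {ψ : Q ≃ Fin N} {p : Fin t → ℕ} (h : IsInsertion φ ψ p) (b : Q ⊕ Fin t ≃ Fin n)
    (before : Q → Q → Prop) (beforeChain : Q → Prop)
    (hb : ∀ q q', b (.inl q) < b (.inl q') ↔ before q q')
    (hbc : ∀ q j, b (.inl q) < b (.inr j) ↔ beforeChain q)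
    (hbt : ∀ i j, b (.inr i) < b (.inr j) ↔ i < j) :
    ((Equiv.Perm.sign (b.symm.trans φ)) : ℤ) =
      (∏ q, ∏ q', if before q q' ∧ ψ q' < ψ q then -1 else 1) *
        (∏ q, if beforeChain q then -1 else 1) ^ t * ∏ j, (-1) ^ p j := by
  have hbc' : ∀ q j, b (.inr j) < b (.inl q) ↔ ¬ beforeChain q := fun q j => by
    have hne : b (.inr j) ≠ b (.inl q) := b.injective.ne (by simp)
    rw [← hbc q j, not_lt]
    exact ⟨le_of_lt, fun h => lt_of_le_of_ne h hne⟩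
  have chain : ∀ i j : Fin t,
      (if b (.inr i) < b (.inr j) ∧ φ (.inr j) < φ (.inr i) then (-1 : ℤ) else 1) = 1 :=
    fun i j => by
      exact if_neg fun hc => absurd ((hbt _ _).1 hc.1) ((h.right_lt_right _ _).1 hc.2).not_gt
  have cross : ∀ j : Fin t,
      (∏ q, if b (.inr j) < b (.inl q) ∧ φ (.inl q) < φ (.inr j) then (-1 : ℤ) else 1) *
        (∏ q, if b (.inl q) < b (.inr j) ∧ φ (.inr j) < φ (.inl q) then (-1 : ℤ) else 1) =
      (∏ q, if beforeChain q then -1 else 1) * (-1) ^ p j := fun j => by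
    have hp : (-1 : ℤ) ^ p j = ∏ q, if (ψ q : ℕ) < p j then -1 else 1 := by
      rw [← Finset.prod_filter, Finset.prod_const, card_filter_equiv_fin_lt ψ (h.le_card j)]
    rw [hp, ← Finset.prod_mul_distrib, ← Finset.prod_mul_distrib]
    refine Finset.prod_congr rfl fun q _ => ?_
    simp only [hbc, hbc', h.left_lt_right, h.right_lt_left]
    by_cases h1 : beforeChain q <;> by_cases h2 : (ψ q : ℕ) < p j
    · simp [h1, h2, h2.not_ge]
    · simp [h1, h2, not_lt.1 h2]
    · simp [h1, h2]
    · simp [h1, h2]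
  rw [sign_symm_trans_eq_prod]
  simp only [Fintype.prod_sum_type, Finset.prod_mul_distrib, chain, Finset.prod_const_one, mul_one]
  rw [Finset.prod_comm (s := (Finset.univ : Finset Q)) (t := (Finset.univ : Finset (Fin t))),
    mul_assoc, ← Finset.prod_mul_distrib, Finset.prod_congr rfl fun j _ => cross j,
    Finset.prod_mul_distrib, Finset.prod_const, Finset.card_univ, Fintype.card_fin, mul_assoc]
  simp only [hb, h.left_lt_left]

theorem exists_equiv_sum_lexSumChains_update {m₀ : ℕ} (m : Fin m₀ → ℕ) (i₀ : Fin m₀) (t : ℕ) :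
    ∃ e : {x : LexSumChains m₀ m // x.1 ≠ i₀} ⊕ Fin t ≃ LexSumChains m₀ (Function.update m i₀ t),
      (∀ q, (e (.inl q)).1 = q.1.1 ∧ ((e (.inl q)).2 : ℕ) = q.1.2) ∧
        ∀ j, (e (.inr j)).1 = i₀ ∧ ((e (.inr j)).2 : ℕ) = j := by
  let f : {x : LexSumChains m₀ m // x.1 ≠ i₀} ⊕ Fin t → LexSumChains m₀ (Function.update m i₀ t) :=
    Sum.elim (fun q => ⟨q.1.1, Fin.cast (Function.update_of_ne q.2 t m).symm q.1.2⟩)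
      fun j => ⟨i₀, Fin.cast (Function.update_self i₀ t m).symm j⟩
  have ext : ∀ {k : Fin m₀ → ℕ} {x y : LexSumChains m₀ k}, x.1 = y.1 → (x.2 : ℕ) = y.2 → x = y := by
    rintro k ⟨i, a⟩ ⟨i', a'⟩ h h'
    obtain rfl : i = i' := h
    obtain rfl : a = a' := Fin.ext h'
    rfl
  have hf : Function.Bijective f := by
    constructor
    · rintro (q | i) (q' | j) h
      · have h1 := congrArg Sigma.fst h
        have h2 := congrArg (fun x => (x.2 : ℕ)) h
        exact congrArg _ (Subtype.ext (ext h1 h2))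
      · exact absurd (congrArg Sigma.fst h) q.2
      · exact absurd (congrArg Sigma.fst h).symm q'.2
      · have h2 := congrArg (fun x => (x.2 : ℕ)) h
        exact congrArg _ (Fin.ext h2)
    · rintro ⟨i, a⟩
      by_cases hi : i = i₀
      · subst hi
        exact ⟨.inr (Fin.cast (Function.update_self i t m) a), ext rfl rfl⟩
      · exact ⟨.inl ⟨⟨i, Fin.cast (Function.update_of_ne hi t m) a⟩, hi⟩, ext rfl rfl⟩
  exact ⟨Equiv.ofBijective f hf, fun q => ⟨rfl, rfl⟩, fun j => ⟨rfl, rfl⟩⟩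

/-- The strict lexicographic order of pairs on a lexicographic sum of chains. -/
def lexBefore {m₀ : ℕ} {m : Fin m₀ → ℕ} (x y : LexSumChains m₀ m) : Prop :=
  x.1 < y.1 ∨ (x.1 = y.1 ∧ (x.2 : ℕ) < (y.2 : ℕ))

theorem IsRef.lt_iff {m₀ : ℕ} {m : Fin m₀ → ℕ} {b : LexSumChains m₀ m ≃ Fin (∑ i, m i)}
    (hb : IsRef m b) (x y : LexSumChains m₀ m) : b x < b y ↔ lexBefore x y := by
  constructor
  · intro h
    by_contra hc
    refine absurd h (not_lt.2 (hb y x ?_))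
    unfold lexBefore at hc
    push Not at hc
    rcases lt_or_eq_of_le hc.1 with h1 | h1
    · exact .inl h1
    · exact .inr ⟨h1, hc.2 h1.symm⟩
  · intro h
    refine lt_of_le_of_ne (hb x y ?_) (b.injective.ne ?_)
    · rcases h with h | h
      · exact .inl h
      · exact .inr ⟨h.1, h.2.le⟩
    · rintro rfl
      rcases h with h | h
      · exact lt_irrefl _ h
      · exact lt_irrefl _ h.2

/-- The positions, among the elements outside the chain `i₀` as ordered by `ψ`, at which elements
of the chain `i₀` may be inserted form a nonempty interval whose length is at most the number of
elements incomparable with that chain. -/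
theorem exists_gap_interval {m₀ : ℕ} {r0 : Fin m₀ → Fin m₀ → Prop}
    (hr0 : IsPartialOrder (Fin m₀) r0) (i₀ : Fin m₀) (m : Fin m₀ → ℕ) {N : ℕ}
    (ψ : {x : LexSumChains m₀ m // x.1 ≠ i₀} ≃ Fin N)
    (hψ : ∀ q q', lexRel r0 m q.1 q'.1 → ψ q ≤ ψ q') :
    ∃ lo k, k ≤ ∑ i ∈ Finset.univ.filter (fun i => i ≠ i₀ ∧ ¬ r0 i i₀ ∧ ¬ r0 i₀ i), m i ∧
      ∀ v : ℕ, (v ≤ N ∧ ∀ q, (r0 q.1.1 i₀ → (ψ q : ℕ) < v) ∧ (r0 i₀ q.1.1 → v ≤ (ψ q : ℕ))) ↔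
        v ∈ Finset.Ico lo (lo + (k + 1)) := by
  let S : Finset ℕ := (Finset.range (N + 1)).filter fun v =>
    ∀ q, (r0 q.1.1 i₀ → (ψ q : ℕ) < v) ∧ (r0 i₀ q.1.1 → v ≤ (ψ q : ℕ))
  have hS : ∀ v, v ∈ S ↔
      v ≤ N ∧ ∀ q, (r0 q.1.1 i₀ → (ψ q : ℕ) < v) ∧ (r0 i₀ q.1.1 → v ≤ (ψ q : ℕ)) := fun v => by
    simp [S]
  have hne : S.Nonempty := by
    refine ⟨(Finset.univ.filter fun q : {x : LexSumChains m₀ m // x.1 ≠ i₀} =>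
      r0 q.1.1 i₀).sup fun q => (ψ q : ℕ) + 1, (hS _).2 ⟨?_, fun q => ⟨fun hq => ?_, fun hq => ?_⟩⟩⟩
    · exact Finset.sup_le fun q _ => (ψ q).2
    · exact Finset.le_sup (f := fun q => (ψ q : ℕ) + 1)
        (Finset.mem_filter.2 ⟨Finset.mem_univ q, hq⟩)
    · refine Finset.sup_le fun q' hq' => ?_
      have hq' := (Finset.mem_filter.1 hq').2
      have hne : q'.1.1 ≠ q.1.1 := fun heq => by
        rw [heq] at hq'
        exact q.2 (hr0.antisymm _ _ hq' hq)
      have hle := hψ q' q (.inr ⟨hne, hr0.trans _ _ _ hq' hq⟩)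
      exact lt_of_le_of_ne hle (ψ.injective.ne fun h => hne (by rw [h]))
  have hmin := (hS _).1 (S.min'_mem hne)
  have hmax := (hS _).1 (S.max'_mem hne)
  have hle : S.min' hne ≤ S.max' hne := S.min'_le _ (S.max'_mem hne)
  refine ⟨S.min' hne, S.max' hne - S.min' hne, ?_, fun v => ?_⟩
  · let T : Finset {x : LexSumChains m₀ m // x.1 ≠ i₀} :=
      Finset.univ.filter fun q => ¬ r0 q.1.1 i₀ ∧ ¬ r0 i₀ q.1.1
    have h1 : (Finset.Ico (S.min' hne) (S.max' hne)).card ≤ T.card := by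
      refine (Finset.card_le_card (t := T.image fun q => (ψ q : ℕ)) fun v hv => ?_).trans
        Finset.card_image_le
      rw [Finset.mem_Ico] at hv
      refine Finset.mem_image.2 ⟨ψ.symm ⟨v, lt_of_lt_of_le hv.2 hmax.1⟩, ?_, by simp⟩
      refine Finset.mem_filter.2 ⟨Finset.mem_univ _, fun h => ?_, fun h => ?_⟩
      · have := (hmin.2 _).1 h
        simp only [Equiv.apply_symm_apply] at this
        omega
      · have := (hmax.2 _).2 h
        simp only [Equiv.apply_symm_apply] at this
        omega
    have h2 : T.card ≤ ((Finset.univ.filter fun i => i ≠ i₀ ∧ ¬ r0 i i₀ ∧ ¬ r0 i₀ i).sigma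
        fun i => (Finset.univ : Finset (Fin (m i)))).card := by
      refine Finset.card_le_card_of_injOn (fun q => q.1) (fun q hq => ?_)
        Subtype.val_injective.injOn
      have hq := (Finset.mem_filter.1 hq).2
      simp [q.2, hq.1, hq.2]
    rw [Nat.card_Ico] at h1
    rw [Finset.card_sigma] at h2
    simpa using h1.trans h2
  · rw [← hS, Finset.mem_Ico]
    constructor
    · intro hv
      have := S.min'_le _ hv
      have := S.le_max' _ hv
      omega
    · intro hv
      refine (hS v).2 ⟨by omega, fun q => ⟨fun hq => ?_, fun hq => ?_⟩⟩
      · have := (hmin.2 q).1 hq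
        omega
      · have := (hmax.2 q).2 hq
        omega

theorem IsInsertion.isLin_iff {m₀ : ℕ} {r0 : Fin m₀ → Fin m₀ → Prop} {i₀ : Fin m₀}
    {m : Fin m₀ → ℕ} {t N : ℕ}
    {e : {x : LexSumChains m₀ m // x.1 ≠ i₀} ⊕ Fin t ≃ LexSumChains m₀ (Function.update m i₀ t)}
    (he : ∀ q, (e (.inl q)).1 = q.1.1 ∧ ((e (.inl q)).2 : ℕ) = q.1.2)
    (he' : ∀ j, (e (.inr j)).1 = i₀ ∧ ((e (.inr j)).2 : ℕ) = j)
    {φ : LexSumChains m₀ (Function.update m i₀ t) ≃ Fin (∑ i, Function.update m i₀ t i)}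
    {ψ : {x : LexSumChains m₀ m // x.1 ≠ i₀} ≃ Fin N} {p : Fin t → ℕ}
    (h : IsInsertion (e.trans φ) ψ p) :
    IsLin r0 (Function.update m i₀ t) φ ↔
      (∀ q q', lexRel r0 m q.1 q'.1 → ψ q ≤ ψ q') ∧
        ∀ j q, (r0 q.1.1 i₀ → (ψ q : ℕ) < p j) ∧ (r0 i₀ q.1.1 → p j ≤ (ψ q : ℕ)) := by
  have rel : ∀ q q', lexRel r0 _ (e (.inl q)) (e (.inl q')) ↔ lexRel r0 m q.1 q'.1 := fun q q' => by
    simp only [lexRel, (he q).1, (he q').1, (he q).2, (he q').2]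
  have hlt := h.left_lt_left
  have hlr := h.left_lt_right
  have hrl := h.right_lt_left
  have hrr := h.right_lt_right
  simp only [Equiv.trans_apply] at hlt hlr hrl hrr
  constructor
  · intro hφ
    refine ⟨fun q q' hqq' => ?_, fun j q => ⟨fun hq => ?_, fun hq => ?_⟩⟩
    · rw [← not_lt, ← hlt, not_lt]
      exact hφ _ _ ((rel q q').2 hqq')
    · rw [← hlr]
      refine lt_of_le_of_ne (hφ _ _ (.inr ?_)) (φ.injective.ne (e.injective.ne (by simp)))
      rw [(he q).1, (he' j).1]
      exact ⟨q.2, hq⟩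
    · rw [← hrl]
      refine lt_of_le_of_ne (hφ _ _ (.inr ?_)) (φ.injective.ne (e.injective.ne (by simp)))
      rw [(he q).1, (he' j).1]
      exact ⟨q.2.symm, hq⟩
  · rintro ⟨h1, h2⟩ x y hxy
    obtain ⟨x, rfl⟩ := e.surjective x
    obtain ⟨y, rfl⟩ := e.surjective y
    rcases x with q | i <;> rcases y with q' | j
    · rw [← not_lt, hlt, not_lt]
      exact h1 _ _ ((rel q q').1 hxy)
    · refine ((hlr _ _).2 ((h2 j q).1 ?_)).le
      rcases hxy with hxy | hxy
      · replace hxy := hxy.1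
        rw [(he q).1, (he' j).1] at hxy
        exact absurd hxy q.2
      · rw [(he q).1, (he' j).1] at hxy
        exact hxy.2
    · refine ((hrl _ _).2 ((h2 i q').2 ?_)).le
      rcases hxy with hxy | hxy
      · replace hxy := hxy.1
        rw [(he q').1, (he' i).1] at hxy
        exact absurd hxy.symm q'.2
      · rw [(he q').1, (he' i).1] at hxy
        exact hxy.2
    · rw [← not_lt, hrr, not_lt]
      rcases hxy with hxy | hxy
      · rw [(he' i).2, (he' j).2] at hxy
        exact hxy.2
      · rw [(he' i).1, (he' j).1] at hxy
        exact absurd rfl hxy.1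

theorem Lminus_update_eq_sum_insertions {m₀ : ℕ} (r0 : Fin m₀ → Fin m₀ → Prop) (i₀ : Fin m₀)
    (m : Fin m₀ → ℕ) (t : ℕ) {N : ℕ}
    (hN : Fintype.card {x : LexSumChains m₀ m // x.1 ≠ i₀} = N)
    (b : LexSumChains m₀ (Function.update m i₀ t) ≃ Fin (∑ i, Function.update m i₀ t i))
    (hb : IsRef (Function.update m i₀ t) b) :
    Lminus m₀ r0 (Function.update m i₀ t) b =
      ∑ ψ : {x : LexSumChains m₀ m // x.1 ≠ i₀} ≃ Fin N,
        ∑ p ∈ (Fintype.piFinset fun _ : Fin t => Finset.range (N + 1)).filter Monotone,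
          if (∀ q q', lexRel r0 m q.1 q'.1 → ψ q ≤ ψ q') ∧
              ∀ j q, (r0 q.1.1 i₀ → (ψ q : ℕ) < p j) ∧ (r0 i₀ q.1.1 → p j ≤ (ψ q : ℕ)) then
            (∏ q, ∏ q', if lexBefore q.1 q'.1 ∧ ψ q' < ψ q then -1 else 1) *
              (∏ q : {x : LexSumChains m₀ m // x.1 ≠ i₀}, if q.1.1 < i₀ then -1 else 1) ^ t *
                ∏ j, (-1) ^ p j
          else 0 := by
  obtain ⟨e, he, he'⟩ := exists_equiv_sum_lexSumChains_update m i₀ t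
  have hn : Fintype.card ({x : LexSumChains m₀ m // x.1 ≠ i₀} ⊕ Fin t) =
      ∑ i, Function.update m i₀ t i := by
    rw [Fintype.card_congr (e.trans b), Fintype.card_fin]
  unfold Lminus
  rw [← Equiv.sum_comp (Equiv.equivCongr e (Equiv.refl _))]
  refine sum_equiv_eq_sum_insertions hN hn _ _ (fun φ ψ p h => ?_) fun φ hφ => if_neg fun hlin => ?_
  · have htrans : e.trans (Equiv.equivCongr e (Equiv.refl _) φ) = φ := by
      ext x
      simp [Equiv.equivCongr]
    have h' : IsInsertion (e.trans (Equiv.equivCongr e (Equiv.refl _) φ)) ψ p := by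
      rwa [htrans]
    have hsymm : b.symm.trans (Equiv.equivCongr e (Equiv.refl _) φ) =
        (e.trans b).symm.trans φ := by
      ext x
      simp [Equiv.equivCongr]
    refine if_congr (h'.isLin_iff he he') ?_ rfl
    rw [hsymm]
    have hsign := h.sign_eq (e.trans b) (fun q q' => lexBefore q.1 q'.1) (fun q => q.1.1 < i₀)
      (fun q q' => ?_) (fun q j => ?_) fun i j => ?_
    · convert hsign
    · simp only [Equiv.trans_apply, hb.lt_iff, lexBefore, he]
    · simp only [Equiv.trans_apply, hb.lt_iff, lexBefore, he, he']
      exact or_iff_left fun hc => q.2 hc.1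
    · simp only [Equiv.trans_apply, hb.lt_iff, lexBefore, he']
      simp
  · refine hφ fun i j hij => ?_
    have hle := hlin (e (.inr i)) (e (.inr j)) (.inl ⟨(he' i).1.trans (he' j).1.symm, by
      rw [(he' i).2, (he' j).2]
      exact hij.le⟩)
    simp only [Equiv.equivCongr_apply_apply, Equiv.symm_apply_apply, Equiv.refl_apply] at hle
    exact lt_of_le_of_ne hle (φ.injective.ne (by simpa using hij.ne))

theorem exists_polynomial_sum_insertions {m₀ : ℕ} {r0 : Fin m₀ → Fin m₀ → Prop}
    (hr0 : IsPartialOrder (Fin m₀) r0) (i₀ : Fin m₀) (m : Fin m₀ → ℕ) {N : ℕ}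
    (ψ : {x : LexSumChains m₀ m // x.1 ≠ i₀} ≃ Fin N) {κ : ℤ} (hκ : κ ^ 2 = 1) (ε : ℤ) :
    ∃ g₀ g₁ : Polynomial ℚ,
      g₀.natDegree ≤
        (∑ i ∈ Finset.univ.filter (fun i : Fin m₀ => i ≠ i₀ ∧ ¬ r0 i i₀ ∧ ¬ r0 i₀ i), m i) / 2 ∧
      g₁.natDegree ≤
        (∑ i ∈ Finset.univ.filter (fun i : Fin m₀ => i ≠ i₀ ∧ ¬ r0 i i₀ ∧ ¬ r0 i₀ i), m i) / 2 ∧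
      ∀ t : ℕ, ∀ s : ℤ,
        s = (∑ p ∈ (Fintype.piFinset fun _ : Fin t => Finset.range (N + 1)).filter Monotone,
          if (∀ q q', lexRel r0 m q.1 q'.1 → ψ q ≤ ψ q') ∧
              ∀ j q, (r0 q.1.1 i₀ → (ψ q : ℕ) < p j) ∧ (r0 i₀ q.1.1 → p j ≤ (ψ q : ℕ)) then
            ε * κ ^ t * ∏ j, (-1) ^ p j
          else 0) →
        (Even t → (s : ℚ) = g₀.eval (t : ℚ)) ∧ (Odd t → (s : ℚ) = g₁.eval (t : ℚ)) := by
  by_cases hψ : ∀ q q', lexRel r0 m q.1 q'.1 → ψ q ≤ ψ q'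
  · obtain ⟨lo, k, hk, hgap⟩ := exists_gap_interval hr0 i₀ m ψ hψ
    obtain ⟨g₀, g₁, hg₀, hg₁, hg⟩ := exists_polynomial_signedMonotoneSum k lo
    have hk2 := Nat.div_le_div_right (c := 2) hk
    refine ⟨Polynomial.C (ε : ℚ) * g₀, Polynomial.C (ε * κ : ℚ) * g₁,
      (Polynomial.natDegree_C_mul_le _ _).trans (hg₀.trans hk2),
      (Polynomial.natDegree_C_mul_le _ _).trans (hg₁.trans hk2), fun t s hs => ?_⟩
    have hsum : s = ε * κ ^ t * signedMonotoneSum (k + 1) lo t := by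
      rw [hs, ← Finset.sum_filter, signedMonotoneSum, Finset.mul_sum]
      refine Finset.sum_congr ?_ fun _ _ => rfl
      ext p
      simp only [Finset.mem_filter, Fintype.mem_piFinset, Finset.mem_range, ← hgap,
        Nat.lt_succ_iff]
      constructor
      · rintro ⟨⟨h1, h2⟩, -, h3⟩
        exact ⟨fun j => ⟨h1 j, h3 j⟩, h2⟩
      · rintro ⟨h1, h2⟩
        exact ⟨⟨fun j => (h1 j).1, h2⟩, hψ, fun j => (h1 j).2⟩
    constructor
    · intro ht
      have hpow : κ ^ t = 1 := by
        obtain ⟨c, rfl⟩ := ht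
        rw [← two_mul, pow_mul, hκ, one_pow]
      rw [hsum, hpow, Int.cast_mul, (hg t).1 ht]
      simp
    · intro ht
      have hpow : κ ^ t = κ := by
        obtain ⟨c, rfl⟩ := ht
        rw [pow_succ, pow_mul, hκ, one_pow, one_mul]
      rw [hsum, hpow, Int.cast_mul, (hg t).2 ht]
      simp
  · refine ⟨0, 0, by simp, by simp, fun t s hs => ?_⟩
    have : s = 0 := by
      rw [hs]
      exact Finset.sum_eq_zero fun p _ => if_neg fun hc => hψ hc.1
    simp [this]

/-- Fixing all the `mᵢ` with `i ≠ i₀`, the values of the sign-imbalance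
`L₋(P₀; m₁,…,m_{m₀})` as a function of `m_{i₀}` are given by two polynomials, one for even
`m_{i₀}` and one for odd `m_{i₀}`, each of degree at most `⌊(∑ mᵢ)/2⌋`, the sum being over
those `i ≠ i₀` such that `xᵢ` is incomparable with `x_{i₀}` in `P₀`. -/
theorem lexSum_signImbalance_two_polynomials_in_one_variable (m₀ : ℕ)
    (r0 : Fin m₀ → Fin m₀ → Prop) (hr0 : IsPartialOrder (Fin m₀) r0)
    (i₀ : Fin m₀) (m : Fin m₀ → ℕ) :
    ∃ f₀ f₁ : Polynomial ℚ,
      f₀.natDegree ≤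
        (∑ i ∈ Finset.univ.filter (fun i : Fin m₀ => i ≠ i₀ ∧ ¬ r0 i i₀ ∧ ¬ r0 i₀ i), m i) / 2 ∧
      f₁.natDegree ≤
        (∑ i ∈ Finset.univ.filter (fun i : Fin m₀ => i ≠ i₀ ∧ ¬ r0 i i₀ ∧ ¬ r0 i₀ i), m i) / 2 ∧
      ∀ t : ℕ,
        ∀ b : LexSumChains m₀ (Function.update m i₀ t) ≃ Fin (∑ i, Function.update m i₀ t i),
          IsRef (Function.update m i₀ t) b →
            (Even t → (Lminus m₀ r0 (Function.update m i₀ t) b : ℚ) = f₀.eval (t : ℚ)) ∧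
            (Odd t → (Lminus m₀ r0 (Function.update m i₀ t) b : ℚ) = f₁.eval (t : ℚ)) := by
  choose g₀ g₁ hg₀ hg₁ hg using fun ψ : {x : LexSumChains m₀ m // x.1 ≠ i₀} ≃ Fin _ =>
    exists_polynomial_sum_insertions hr0 i₀ m ψ
      (κ := ∏ q : {x : LexSumChains m₀ m // x.1 ≠ i₀}, if q.1.1 < i₀ then -1 else 1)
      (by
        rw [← Finset.prod_pow]
        exact Finset.prod_eq_one fun q _ => by split_ifs <;> norm_num)
      (∏ q, ∏ q', if lexBefore q.1 q'.1 ∧ ψ q' < ψ q then -1 else 1)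
  refine ⟨∑ ψ, g₀ ψ, ∑ ψ, g₁ ψ, Polynomial.natDegree_sum_le_of_forall_le _ _ fun ψ _ => hg₀ ψ,
    Polynomial.natDegree_sum_le_of_forall_le _ _ fun ψ _ => hg₁ ψ, fun t b hb => ?_⟩
  rw [Lminus_update_eq_sum_insertions r0 i₀ m t rfl b hb, Int.cast_sum, Polynomial.eval_finsetSum,
    Polynomial.eval_finsetSum]
  exact ⟨fun ht => Finset.sum_congr rfl fun ψ _ => (hg ψ t _ rfl).1 ht,
    fun ht => Finset.sum_congr rfl fun ψ _ => (hg ψ t _ rfl).2 ht⟩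
end

section
/- Let P₀ be a finite poset with elements x₁,…,x_{m₀}, and let S ⊆ |P₀| be a chain in P₀. Fix nonnegative values mᵢ for all i with xᵢ ∉ S. Then the function of the remaining variables (mᵢ for xᵢ ∈ S) given by L₊(P₀; m₁,…,m_{m₀}) is a polynomial function in those card(S) variables. -/
open scoped Classical

/-- The number of linearizations of the relation `r` on `α` by an initial segment of `ℕ`. -/
noncomputable def linExtCount {α : Type*} (r : α → α → Prop) (n : ℕ) : ℕ :=
  Nat.card {φ : α ≃ Fin n // ∀ x y, r x y → φ x ≤ φ y}

theorem linExtCount_congr {α β : Type*} {r : α → α → Prop} {r' : β → β → Prop} (e : α ≃ β)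
    (h : ∀ x y, r x y ↔ r' (e x) (e y)) (n : ℕ) : linExtCount r n = linExtCount r' n := by
  refine Nat.card_congr ((Equiv.equivCongr e (Equiv.refl (Fin n))).subtypeEquiv fun φ => ?_)
  constructor
  · intro H x y hxy
    have := H (e.symm x) (e.symm y) ((h _ _).2 (by simpa using hxy))
    simpa using this
  · intro H x y hxy
    have := H _ _ ((h x y).1 hxy)
    simpa using this

theorem ne_last_iff {α : Type*} {x : α} {n : ℕ} {φ : α ≃ Fin (n + 1)} (h : φ x = Fin.last n)
    (y : α) : y ≠ x ↔ φ y ≠ Fin.last n := by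
  rw [← h, φ.injective.ne_iff]

/-- The restriction of a bijection `α ≃ Fin (n + 1)` to the complement of its largest element. -/
noncomputable def restrictNeLast {α : Type*} (x : α) (n : ℕ)
    (φ : {φ : α ≃ Fin (n + 1) // φ x = Fin.last n}) : {y : α // y ≠ x} ≃ Fin n :=
  (φ.1.subtypeEquiv (p := fun y => y ≠ x) (q := fun k => k ≠ Fin.last n)
    fun y => ne_last_iff φ.2 y).trans (finSuccAboveEquiv (Fin.last n)).symm

theorem castSucc_restrictNeLast {α : Type*} (x : α) (n : ℕ)
    (φ : {φ : α ≃ Fin (n + 1) // φ x = Fin.last n}) (y : {y : α // y ≠ x}) :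
    (restrictNeLast x n φ y).castSucc = φ.1 y := by
  have h (k : {k : Fin (n + 1) // k ≠ Fin.last n}) :
      ((finSuccAboveEquiv (Fin.last n)).symm k).castSucc = k.1 := by
    obtain ⟨j, rfl⟩ := (finSuccAboveEquiv (Fin.last n)).surjective k
    rw [Equiv.symm_apply_apply]
    simp [finSuccAboveEquiv_apply]
  exact h _

theorem restrictNeLast_bijective {α : Type*} (x : α) (n : ℕ) :
    Function.Bijective (restrictNeLast x n) := by
  constructor
  · intro φ ψ h
    ext y
    by_cases hy : y = x
    · rw [hy, φ.2, ψ.2]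
    · rw [← castSucc_restrictNeLast x n φ ⟨y, hy⟩, h, castSucc_restrictNeLast]
  · intro ψ
    refine ⟨⟨(Equiv.optionSubtypeNe x).symm.trans
      ((Equiv.optionCongr ψ).trans finSuccEquivLast.symm), by simp⟩, ?_⟩
    ext y
    rw [← Fin.val_castSucc, castSucc_restrictNeLast]
    simp [Equiv.optionSubtypeNe_symm_of_ne y.2]

theorem linExtCount_succ {α : Type*} [Fintype α] (r : α → α → Prop) (n : ℕ) :
    linExtCount r (n + 1) = ∑ x : α, if ∀ y, r x y → y = x then
      linExtCount (fun y z : {y : α // y ≠ x} => r y z) n else 0 := by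
  have hsum : linExtCount r (n + 1) = ∑ x : α, Nat.card
      {φ : {φ : α ≃ Fin (n + 1) // φ x = Fin.last n} // ∀ y z, r y z → φ.1 y ≤ φ.1 z} := by
    rw [linExtCount, ← Nat.card_sigma]
    refine Nat.card_congr
      { toFun := fun φ => ⟨φ.1.symm (Fin.last n), ⟨φ.1, by simp⟩, φ.2⟩
        invFun := fun p => ⟨p.2.1.1, p.2.2⟩
        left_inv := fun φ => rfl
        right_inv := ?_ }
    rintro ⟨x, ⟨φ, h⟩, h'⟩
    obtain rfl : φ.symm (Fin.last n) = x := by rw [← h]; simp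
    rfl
  rw [hsum]
  refine Finset.sum_congr rfl fun x _ => ?_
  split_ifs with hx
  · refine Nat.card_congr ((Equiv.ofBijective _ (restrictNeLast_bijective x n)).subtypeEquiv fun φ => ?_)
    constructor
    · intro H y z hyz
      rw [Equiv.ofBijective_apply, ← Fin.castSucc_le_castSucc_iff, castSucc_restrictNeLast, castSucc_restrictNeLast]
      exact H _ _ hyz
    · intro H y z hyz
      by_cases hz : z = x
      · subst hz; rw [φ.2]; exact Fin.le_last _
      · have hy : y ≠ x := by rintro rfl; exact hz (hx _ hyz)
        have := H ⟨y, hy⟩ ⟨z, hz⟩ hyz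
        rwa [Equiv.ofBijective_apply, ← Fin.castSucc_le_castSucc_iff, castSucc_restrictNeLast,
          castSucc_restrictNeLast] at this
  · rw [Nat.card_eq_zero]
    left
    refine ⟨fun φ => hx fun y hy => ?_⟩
    have := φ.2 _ _ hy
    rw [φ.1.2, Fin.last_le_iff] at this
    exact φ.1.1.injective (this.trans φ.1.2.symm)

theorem Lplus_eq_linExtCount {m₀ : ℕ} (r0 : Fin m₀ → Fin m₀ → Prop) {m : Fin m₀ → ℕ} {n : ℕ}
    (hn : ∑ i, m i = n) : Lplus m₀ r0 m = linExtCount (lexRel r0 m) n := by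
  subst hn; rfl

theorem linExtCount_lexRel_remove {m₀ : ℕ} (r0 : Fin m₀ → Fin m₀ → Prop) (m : Fin m₀ → ℕ)
    (i : Fin m₀) (k : Fin (m i)) (hk : (k : ℕ) + 1 = m i) (n : ℕ) (hn : ∑ j, m j = n + 1) :
    linExtCount (fun y z : {y : LexSumChains m₀ m // y ≠ ⟨i, k⟩} => lexRel r0 m y z) n =
      Lplus m₀ r0 (Function.update m i (m i - 1)) := by
  have hsum : ∑ j, Function.update m i (m i - 1) j = n := by
    have h1 := Finset.sum_update_of_mem (Finset.mem_univ i) m (m i - 1)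
    have h2 := Finset.add_sum_erase Finset.univ m (Finset.mem_univ i)
    rw [← Finset.erase_eq] at h1
    omega
  rw [Lplus_eq_linExtCount r0 hsum]
  have hto (y : {y : LexSumChains m₀ m // y ≠ ⟨i, k⟩}) :
      (y.1.2 : ℕ) < Function.update m i (m i - 1) y.1.1 := by
    obtain ⟨⟨j, l⟩, h⟩ := y
    by_cases hj : j = i
    · subst hj
      have : (l : ℕ) ≠ k := fun hl => h (by rw [Fin.ext hl])
      have := l.2
      simp only [Function.update_self]
      omega
    · simp [Function.update_of_ne hj]
  have hlt (y : LexSumChains m₀ (Function.update m i (m i - 1))) : (y.2 : ℕ) < m y.1 := by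
    obtain ⟨j, l, hl⟩ := y
    refine lt_of_lt_of_le hl ?_
    by_cases hj : j = i
    · subst hj; simp
    · simp [Function.update_of_ne hj]
  have hne (y : LexSumChains m₀ (Function.update m i (m i - 1))) :
      (⟨y.1, y.2, hlt y⟩ : LexSumChains m₀ m) ≠ ⟨i, k⟩ := by
    obtain ⟨j, l, hl⟩ := y
    intro h
    obtain rfl : j = i := congrArg Sigma.fst h
    have := congrArg Fin.val (eq_of_heq (Sigma.mk.inj h).2)
    simp only [Function.update_self] at hl this
    omega
  let e : {y : LexSumChains m₀ m // y ≠ ⟨i, k⟩} ≃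
      LexSumChains m₀ (Function.update m i (m i - 1)) :=
    { toFun := fun y => ⟨y.1.1, y.1.2, hto y⟩
      invFun := fun y => ⟨⟨y.1, y.2, hlt y⟩, hne y⟩
      left_inv := fun _ => rfl
      right_inv := fun _ => rfl }
  exact linExtCount_congr (r' := lexRel r0 _) e (fun _ _ => Iff.rfl) n

theorem lexRel_maximal_iff {m₀ : ℕ} (r0 : Fin m₀ → Fin m₀ → Prop) (m : Fin m₀ → ℕ)
    (i : Fin m₀) (k : Fin (m i)) :
    (∀ y, lexRel r0 m ⟨i, k⟩ y → y = ⟨i, k⟩) ↔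
      (k : ℕ) + 1 = m i ∧ ∀ j, j ≠ i → r0 i j → m j = 0 := by
  constructor
  · intro h
    refine ⟨?_, fun j hj hij => ?_⟩
    · by_contra hk
      have hk' : (k : ℕ) + 1 < m i := by have := k.2; omega
      have := h ⟨i, ⟨k + 1, hk'⟩⟩ (Or.inl ⟨rfl, by simp⟩)
      have := congrArg Fin.val (eq_of_heq (Sigma.mk.inj this).2)
      simp at this
    · by_contra hm
      exact hj (congrArg Sigma.fst
        (h ⟨j, ⟨0, Nat.pos_of_ne_zero hm⟩⟩ (Or.inr ⟨hj.symm, hij⟩)))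
  · rintro ⟨hk, h⟩ ⟨j, l⟩ (⟨hj, hl⟩ | ⟨hj, hij⟩)
    · obtain rfl : i = j := hj
      have := l.2
      have : l = k := Fin.ext (by simp only at hl; omega)
      rw [this]
    · have := h j (Ne.symm hj) hij
      have := l.2
      omega

/-- Removing the largest element of a linearization, which must be the last element of a chain
with no nonempty chain above it. -/
theorem Lplus_eq_sum {m₀ : ℕ} (r0 : Fin m₀ → Fin m₀ → Prop) (m : Fin m₀ → ℕ)
    (hm : ∑ j, m j ≠ 0) :
    Lplus m₀ r0 m = ∑ i, if 0 < m i ∧ ∀ j, j ≠ i → r0 i j → m j = 0 then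
      Lplus m₀ r0 (Function.update m i (m i - 1)) else 0 := by
  obtain ⟨n, hn⟩ := Nat.exists_eq_succ_of_ne_zero hm
  rw [Lplus_eq_linExtCount r0 hn, linExtCount_succ, Fintype.sum_sigma]
  refine Finset.sum_congr rfl fun i _ => ?_
  simp only [lexRel_maximal_iff]
  by_cases hi : 0 < m i
  · have hlt : m i - 1 < m i := by omega
    rw [Finset.sum_eq_single ⟨m i - 1, hlt⟩]
    · have : m i - 1 + 1 = m i := by omega
      rw [linExtCount_lexRel_remove r0 m i _ this n hn]
      simp [hi, this]
    · intro k _ hk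
      rw [if_neg]
      rintro ⟨h, -⟩
      exact hk (Fin.ext (by simp only; omega))
    · simp
  · rw [if_neg (by tauto)]
    refine Finset.sum_eq_zero fun k _ => ?_
    have := k.2
    omega

/-- `DegreeLT d g` says that the `d`-th difference of `g` vanishes, i.e. that `g` is a polynomial
function of degree less than `d`. -/
def DegreeLT (d : ℕ) (g : ℕ → ℚ) : Prop := ∀ t, (fwdDiff 1)^[d] g t = 0

namespace DegreeLT

theorem sum {ι : Type*} {s : Finset ι} {g : ι → ℕ → ℚ} {d : ℕ} (h : ∀ i ∈ s, DegreeLT d (g i)) :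
    DegreeLT d (fun t => ∑ i ∈ s, g i t) := by
  intro t
  have : (fun t => ∑ i ∈ s, g i t) = ∑ i ∈ s, g i := by ext; simp
  rw [this, fwdDiff_iter_finsetSum, Finset.sum_apply]
  exact Finset.sum_eq_zero fun i hi => h i hi t

theorem shift {g : ℕ → ℚ} {d : ℕ} (h : DegreeLT d g) : DegreeLT d (fun t => g (t + 1)) := by
  intro t
  rw [fwdDiff_iter_comp_add 1 g 1 d t]
  exact h _

theorem succ {g h : ℕ → ℚ} {d : ℕ} (hh : DegreeLT d h) (hg : ∀ t, g (t + 1) = g t + h t) :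
    DegreeLT (d + 1) g := by
  intro t
  have : fwdDiff 1 g = h := by ext t; simp [fwdDiff, hg]
  rw [Function.iterate_succ_apply, this]
  exact hh t

theorem zero_fun (d : ℕ) : DegreeLT d (fun _ => 0) := by
  simpa using sum (s := (∅ : Finset ℕ)) (g := fun _ _ => 0) (d := d) (by simp)

theorem mono {g : ℕ → ℚ} {d e : ℕ} (h : DegreeLT d g) (hde : d ≤ e) : DegreeLT e g := by
  obtain ⟨k, rfl⟩ := Nat.exists_eq_add_of_le hde
  intro t
  have : (fwdDiff 1)^[d] g = fun _ => 0 := funext h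
  rw [add_comm, Function.iterate_add_apply, this]
  exact zero_fun k t

theorem eq_sum {g : ℕ → ℚ} {d : ℕ} (h : DegreeLT d g) (t : ℕ) :
    g t = ∑ k ∈ Finset.range d, t.choose k * (fwdDiff 1)^[k] g 0 := by
  have h1 := shift_eq_sum_fwdDiff_iter 1 g t 0
  simp only [zero_add, smul_eq_mul, mul_one, nsmul_eq_mul] at h1
  rw [h1]
  rcases le_total (t + 1) d with hd | hd
  · refine Finset.sum_subset (by simpa using hd) fun k _ hk => ?_
    rw [Nat.choose_eq_zero_of_lt (by simpa using hk)]; simp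
  · refine (Finset.sum_subset (by simpa using hd) fun k _ hk => ?_).symm
    rw [h.mono (by simpa using hk : d ≤ k) 0, mul_zero]

end DegreeLT

theorem exists_mvPolynomial_choose {ι : Type*} (s : ι) (k : ℕ) :
    ∃ p : MvPolynomial ι ℚ, ∀ v : ι → ℕ, ((v s).choose k : ℚ) =
      MvPolynomial.eval (fun i => (v i : ℚ)) p := by
  refine ⟨Polynomial.aeval (MvPolynomial.X s) (Polynomial.C (k.factorial : ℚ)⁻¹ *
    descPochhammer ℚ k), fun v => ?_⟩
  rw [← MvPolynomial.coe_aeval_eq_eval, RingHom.coe_coe, ← Polynomial.aeval_algHom_apply]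
  rw [Nat.cast_choose_eq_descPochhammer_div]
  simp [div_eq_inv_mul]

theorem exists_mvPolynomial_of_degreeLT {ι : Type*} [DecidableEq ι] (f : (ι → ℕ) → ℚ) (d : ℕ)
    (S : Finset ι) (m : ι → ℕ)
    (h : ∀ s ∈ S, ∀ m' : ι → ℕ, (∀ i ∉ S, m' i = m i) →
      DegreeLT d (fun t => f (Function.update m' s t))) :
    ∃ p : MvPolynomial ι ℚ, ∀ v : ι → ℕ,
      f (S.piecewise v m) = MvPolynomial.eval (fun i => (v i : ℚ)) p := by
  suffices H : ∀ T ⊆ S, ∀ m' : ι → ℕ, (∀ i ∉ S, m' i = m i) → ∃ p : MvPolynomial ι ℚ,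
      ∀ v : ι → ℕ, f (T.piecewise v m') = MvPolynomial.eval (fun i => (v i : ℚ)) p from
    H S subset_rfl m fun _ _ => rfl
  intro T
  induction T using Finset.induction_on with
  | empty => exact fun _ m' _ => ⟨MvPolynomial.C (f m'), by simp⟩
  | insert s T hs ih =>
    intro hT m' hm'
    have hsS : s ∈ S := hT (Finset.mem_insert_self s T)
    have hTS : T ⊆ S := (Finset.subset_insert s T).trans hT
    choose p hp using fun j : ℕ => ih hTS (Function.update m' s j) fun i hi => by
      rw [Function.update_of_ne (ne_of_mem_of_not_mem hsS hi).symm, hm' i hi]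
    choose c hc using exists_mvPolynomial_choose s
    refine ⟨∑ k ∈ Finset.range d, c k * ∑ j ∈ Finset.range (k + 1),
      MvPolynomial.C (((-1 : ℤ) ^ (k - j) * k.choose j : ℤ) : ℚ) * p j, fun v => ?_⟩
    have hdeg := h s hsS (T.piecewise v m') fun i hi => by
      rw [Finset.piecewise_eq_of_notMem _ _ _ (fun hiT => hi (hTS hiT)), hm' i hi]
    rw [Finset.piecewise_insert, hdeg.eq_sum (v s), map_sum]
    refine Finset.sum_congr rfl fun k _ => ?_
    rw [map_mul, ← hc, fwdDiff_iter_eq_sum_shift, map_sum]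
    congr 1
    refine Finset.sum_congr rfl fun j _ => ?_
    rw [map_mul, ← hp, MvPolynomial.eval_C, zsmul_eq_mul]
    simp [Finset.update_piecewise_of_notMem _ _ _ hs]

/-- As a function of the length of the chain at `s`, the number of linearizations is a polynomial
of degree at most the number of elements of the lexicographic sum that are incomparable to `s`. -/
theorem Lplus_update_degreeLT {m₀ : ℕ} (r0 : Fin m₀ → Fin m₀ → Prop)
    (hr0 : IsPartialOrder (Fin m₀) r0) (s : Fin m₀) (m : Fin m₀ → ℕ) (d : ℕ)
    (hd : ∑ i with ¬ r0 i s ∧ ¬ r0 s i, m i ≤ d) :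
    DegreeLT (d + 1) (fun t => (Lplus m₀ r0 (Function.update m s t) : ℚ)) := by
  induction hN : ∑ i ∈ Finset.univ.erase s, m i using Nat.strong_induction_on generalizing m d with
  | _ N ih =>
  subst hN
  set dec : Fin m₀ → Fin m₀ → ℕ := fun i => Function.update m i (m i - 1) with hdec
  have hdec_le (i j : Fin m₀) : dec i j ≤ m j := by
    by_cases hij : j = i
    · subst hij; simp [hdec]
    · simp [hdec, hij]
  have hdec_lt (T : Finset (Fin m₀)) {i : Fin m₀} (hi : i ∈ T) (hmi : 0 < m i) :
      ∑ j ∈ T, dec i j < ∑ j ∈ T, m j :=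
    Finset.sum_lt_sum (fun j _ => hdec_le i j) ⟨i, hi, by simp [hdec]; omega⟩
  have hcomm (i : Fin m₀) (hi : i ≠ s) (t : ℕ) : Function.update (Function.update m s t) i
      (Function.update m s t i - 1) = Function.update (dec i) s t := by
    rw [Function.update_of_ne hi, Function.update_comm hi.symm]
  by_cases hA : ∃ j, j ≠ s ∧ r0 s j ∧ 0 < m j
  · obtain ⟨a, has, hsa, ha⟩ := hA
    have hrec : (fun t => (Lplus m₀ r0 (Function.update m s t) : ℚ)) = fun t =>
        ∑ i ∈ Finset.univ.erase s with 0 < m i ∧ ∀ j, j ≠ s → j ≠ i → r0 i j → m j = 0,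
          (Lplus m₀ r0 (Function.update (dec i) s t) : ℚ) := by
      ext t
      have hne : ∑ j, Function.update m s t j ≠ 0 := fun h => by
        have := Finset.sum_eq_zero_iff.1 h a (Finset.mem_univ a)
        rw [Function.update_of_ne has] at this
        omega
      rw [Lplus_eq_sum r0 _ hne, ← Finset.add_sum_erase _ _ (Finset.mem_univ s), if_neg, zero_add,
        Finset.sum_filter, Nat.cast_sum]
      · refine Finset.sum_congr rfl fun i hi => ?_
        have his := Finset.ne_of_mem_erase hi
        rw [hcomm i his, Function.update_of_ne his]
        have hiff : (0 < m i ∧ ∀ j, j ≠ i → r0 i j → Function.update m s t j = 0) ↔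
            (0 < m i ∧ ∀ j, j ≠ s → j ≠ i → r0 i j → m j = 0) := by
          refine and_congr_right fun _ => ⟨fun h j hjs hji hij => ?_, fun h j hji hij => ?_⟩
          · simpa [hjs] using h j hji hij
          · by_cases hjs : j = s
            · subst hjs
              have hai : a ≠ i := by
                rintro rfl
                exact his (hr0.antisymm _ _ hij hsa)
              have := h a has hai (hr0.trans _ _ _ hij hsa)
              omega
            · simpa [hjs] using h j hjs hji hij
        simp only [hiff]
        split_ifs <;> simp
      · rintro ⟨-, h⟩
        have := h a has hsa
        rw [Function.update_of_ne has] at this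
        omega
    rw [hrec]
    refine DegreeLT.sum fun i hi => ?_
    obtain ⟨hi, hmi, -⟩ := Finset.mem_filter.1 hi
    exact ih _ (hdec_lt _ hi hmi) _ _ ((Finset.sum_le_sum fun j _ => hdec_le i j).trans hd) rfl
  · have hA' (j : Fin m₀) (hjs : j ≠ s) (hsj : r0 s j) : m j = 0 := by
      by_contra hj
      exact hA ⟨j, hjs, hsj, Nat.pos_of_ne_zero hj⟩
    refine DegreeLT.succ (h := fun t => ∑ i ∈ Finset.univ.erase s with
      0 < m i ∧ ¬ r0 i s ∧ ∀ j, j ≠ s → j ≠ i → r0 i j → m j = 0,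
        (Lplus m₀ r0 (Function.update (dec i) s (t + 1)) : ℚ)) (DegreeLT.sum fun i hi => ?_)
      fun t => ?_
    · obtain ⟨hi, hmi, his, -⟩ := Finset.mem_filter.1 hi
      have hsi : ¬ r0 s i := fun h => hmi.ne' (hA' i (Finset.ne_of_mem_erase hi) h)
      have hlt := hdec_lt (Finset.univ.filter fun i => ¬ r0 i s ∧ ¬ r0 s i)
        (i := i) (by simp [his, hsi]) hmi
      obtain ⟨e, rfl⟩ : ∃ e, d = e + 1 := ⟨d - 1, by omega⟩
      exact (ih _ (hdec_lt _ hi hmi) (dec i) e (by omega) rfl).shift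
    · have hne : ∑ j, Function.update m s (t + 1) j ≠ 0 := fun h => by
        have := Finset.sum_eq_zero_iff.1 h s (Finset.mem_univ s)
        simp at this
      rw [Lplus_eq_sum r0 _ hne, ← Finset.add_sum_erase _ _ (Finset.mem_univ s), if_pos,
        Finset.sum_filter, Nat.cast_add, Nat.cast_sum]
      · congr 1
        · simp
        · refine Finset.sum_congr rfl fun i hi => ?_
          have his := Finset.ne_of_mem_erase hi
          rw [hcomm i his, Function.update_of_ne his]
          have hiff : (0 < m i ∧ ∀ j, j ≠ i → r0 i j → Function.update m s (t + 1) j = 0) ↔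
              (0 < m i ∧ ¬ r0 i s ∧ ∀ j, j ≠ s → j ≠ i → r0 i j → m j = 0) := by
            refine and_congr_right fun _ => ⟨fun h => ⟨fun h' => ?_, fun j hjs hji hij => ?_⟩,
              fun h j hji hij => ?_⟩
            · simpa using h s his.symm h'
            · simpa [hjs] using h j hji hij
            · have hjs : j ≠ s := by rintro rfl; exact h.1 hij
              simpa [hjs] using h.2 j hjs hji hij
          simp only [hiff]
          split_ifs <;> simp
      · refine ⟨by simp, fun j hjs hsj => ?_⟩
        rw [Function.update_of_ne hjs, hA' j hjs hsj]

/-- Theorem, "if" direction. If `S` is a chain in `P₀` and the values `mᵢ`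
with `xᵢ ∉ S` are fixed, then `L₊(P₀; m₁,…,m_{m₀})`, as a function of the remaining variables
`mᵢ` with `xᵢ ∈ S`, is given by a polynomial in those `card S` variables. -/
theorem lexSum_linearizationCount_polynomial_in_chain_variables (m₀ : ℕ)
    (r0 : Fin m₀ → Fin m₀ → Prop) (hr0 : IsPartialOrder (Fin m₀) r0)
    (S : Finset (Fin m₀)) (hS : IsChain r0 (↑S : Set (Fin m₀))) (m : Fin m₀ → ℕ) :
    ∃ f : MvPolynomial {i : Fin m₀ // i ∈ S} ℚ,
      ∀ v : {i : Fin m₀ // i ∈ S} → ℕ,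
        (Lplus m₀ r0 (fun i => if h : i ∈ S then v ⟨i, h⟩ else m i) : ℚ) =
          MvPolynomial.eval (fun j => (v j : ℚ)) f := by
  obtain ⟨p, hp⟩ := exists_mvPolynomial_of_degreeLT (fun m' => (Lplus m₀ r0 m' : ℚ))
    (∑ i, m i + 1) S m fun s hs m' hm' => by
      refine Lplus_update_degreeLT r0 hr0 s m' _ ?_
      refine le_trans (le_of_eq (Finset.sum_congr rfl fun i hi => hm' i fun hiS => ?_))
        (Finset.sum_le_sum_of_subset (Finset.subset_univ _))
      obtain ⟨his, hsi⟩ := (Finset.mem_filter.1 hi).2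
      rcases eq_or_ne i s with rfl | hne
      · exact his (hr0.refl _)
      · exact (hS hiS hs hne).elim his hsi
  refine ⟨MvPolynomial.aeval (fun i => if h : i ∈ S then MvPolynomial.X ⟨i, h⟩ else 0) p,
    fun v => ?_⟩
  have hm : (fun i => if h : i ∈ S then v ⟨i, h⟩ else m i) =
      S.piecewise (fun i => if h : i ∈ S then v ⟨i, h⟩ else 0) m := by
    ext i
    by_cases h : i ∈ S <;> simp [h]
  rw [hm, hp, ← MvPolynomial.coe_aeval_eq_eval, ← MvPolynomial.coe_aeval_eq_eval,
    RingHom.coe_coe, RingHom.coe_coe,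
    MvPolynomial.comp_aeval_apply (φ := MvPolynomial.aeval fun j => (v j : ℚ))]
  congr 2
  ext i
  by_cases h : i ∈ S <;> simp [h]
end

section
/- Let P₀ be a finite poset with elements x₁,…,x_{m₀}, and let S ⊆ |P₀| be a chain in P₀. Fix nonnegative values mᵢ for all i with xᵢ ∉ S. Then the values of L₋(P₀; m₁,…,m_{m₀}) as a function of the variables mᵢ with xᵢ ∈ S are given by 2^{card(S)} polynomials in those variables, one for each choice of the parities (even or odd) of these card(S) variables. -/
open scoped Classical

open Finset Equiv Function

/-- The order of the lexicographic sum, transported along a labelling of an initial segment. -/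
def labRel {ι : Type*} (r : ι → ι → Prop) {n : ℕ} (lab : Fin n → ι) (x y : Fin n) : Prop :=
  (lab x = lab y ∧ x ≤ y) ∨ (lab x ≠ lab y ∧ r (lab x) (lab y))

/-- The sign-imbalance of a relation on `Fin n` with respect to the natural ordering. -/
noncomputable def permImbalance (n : ℕ) (R : Fin n → Fin n → Prop) : ℤ :=
  ∑ σ : Perm (Fin n), if ∀ x y, R x y → σ x ≤ σ y then (Perm.sign σ : ℤ) else 0

lemma sum_perm_fin_succ {M : Type*} [AddCommMonoid M] (n : ℕ) (f : Perm (Fin (n + 1)) → M) :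
    ∑ σ, f σ = ∑ a : Fin (n + 1), ∑ τ : Perm (Fin n),
      f (Perm.decomposeFin.symm (0, τ) * a.cycleRange) := by
  rw [← Fintype.sum_prod_type']
  symm
  apply Fintype.sum_bijective
    (fun p : Fin (n + 1) × Perm (Fin n) => Perm.decomposeFin.symm (0, p.2) * p.1.cycleRange)
  · rw [Fintype.bijective_iff_injective_and_card]
    refine ⟨?_, ?_⟩
    · rintro ⟨a, τ⟩ ⟨a', τ'⟩ h
      have key : ∀ (c : Fin (n + 1)) (ρ : Perm (Fin n)),
          (Perm.decomposeFin.symm (0, ρ) * c.cycleRange) c = 0 := by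
        intro c ρ
        simp
      have haa : a = a' := by
        apply (Perm.decomposeFin.symm (0, τ) * a.cycleRange).injective
        rw [key]
        simp only at h
        rw [h, key]
      subst haa
      simp only [mul_left_inj, EmbeddingLike.apply_eq_iff_eq, Prod.mk.injEq, true_and] at h
      rw [h]
    · simp [Fintype.card_perm, Nat.factorial_succ]
  · intro p
    rfl

lemma permImbalance_succ (n : ℕ) (R : Fin (n + 1) → Fin (n + 1) → Prop) :
    permImbalance (n + 1) R = ∑ a : Fin (n + 1), if ∀ x, R x a → x = a then
      (-1) ^ (a : ℕ) * permImbalance n (fun x y => R (a.succAbove x) (a.succAbove y)) else 0 := by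
  unfold permImbalance
  rw [sum_perm_fin_succ]
  refine sum_congr rfl fun a _ => ?_
  have h0 : ∀ τ : Perm (Fin n), (Perm.decomposeFin.symm (0, τ) * a.cycleRange) a = 0 := by
    intro τ; simp
  have h1 : ∀ (τ : Perm (Fin n)) (x : Fin n),
      (Perm.decomposeFin.symm (0, τ) * a.cycleRange) (a.succAbove x) = (τ x).succ := by
    intro τ x; simp
  have hiff : ∀ τ : Perm (Fin n),
      (∀ x y, R x y → (Perm.decomposeFin.symm (0, τ) * a.cycleRange) x ≤
        (Perm.decomposeFin.symm (0, τ) * a.cycleRange) y) ↔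
      (∀ x, R x a → x = a) ∧ ∀ x y, R (a.succAbove x) (a.succAbove y) → τ x ≤ τ y := by
    intro τ
    constructor
    · intro h
      refine ⟨fun x hx => ?_, fun x y hxy => ?_⟩
      · have := h x a hx
        exact (Perm.decomposeFin.symm (0, τ) * a.cycleRange).injective
          ((Fin.le_zero_iff.1 (this.trans_eq (h0 τ))).trans (h0 τ).symm)
      · have := h _ _ hxy
        rwa [h1, h1, Fin.succ_le_succ_iff] at this
    · rintro ⟨ha, h⟩ x y hxy
      rcases Fin.eq_self_or_eq_succAbove a x with rfl | ⟨x, rfl⟩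
      · rw [h0]; exact Fin.zero_le _
      · rcases Fin.eq_self_or_eq_succAbove a y with rfl | ⟨y, rfl⟩
        · exact absurd (ha _ hxy) (Fin.succAbove_ne _ _)
        · rw [h1, h1, Fin.succ_le_succ_iff]
          exact h _ _ hxy
  have hs : ∀ τ : Perm (Fin n), Perm.sign (Perm.decomposeFin.symm (0, τ) * a.cycleRange) =
      (-1) ^ (a : ℕ) * Perm.sign τ := by
    intro τ
    rw [Perm.sign_mul, Perm.decomposeFin.symm_sign, Fin.sign_cycleRange]
    simp [mul_comm]
  simp only [hiff, hs]
  split_ifs with ha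
  · rw [mul_sum]
    refine sum_congr rfl fun τ _ => ?_
    simp only [eq_true ha, true_and]
    split_ifs <;> simp
  · simp only [eq_false ha, false_and, if_false, sum_const_zero]

/-- The sign-imbalance as a function of the chain lengths, computed by removing a minimal
element `n` times. -/
noncomputable def chainImbalance {m₀ : ℕ} (r : Fin m₀ → Fin m₀ → Prop) :
    ℕ → (Fin m₀ → ℕ) → ℤ
  | 0, _ => 1
  | n + 1, m => ∑ i, if 0 < m i ∧ ∀ k, k ≠ i → r k i → m k = 0 then
      (-1) ^ (∑ k ∈ Iio i, m k) * chainImbalance r n (update m i (m i - 1)) else 0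

/-- The number of elements carrying a given label. -/
def labCount {m₀ n : ℕ} (lab : Fin n → Fin m₀) (i : Fin m₀) : ℕ :=
  #{x | lab x = i}

lemma labCount_succAbove {m₀ n : ℕ} (lab : Fin (n + 1) → Fin m₀) (a : Fin (n + 1)) :
    labCount (fun x => lab (a.succAbove x)) =
      update (labCount lab) (lab a) (labCount lab (lab a) - 1) := by
  have key : ∀ i, labCount lab i =
      (if lab a = i then 1 else 0) + labCount (fun x => lab (a.succAbove x)) i := by
    intro i
    simp only [labCount, card_filter]
    rw [Fin.sum_univ_succAbove _ a]
  funext i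
  rcases eq_or_ne i (lab a) with rfl | h
  · rw [update_self, key]; simp
  · rw [update_of_ne h, key i, if_neg h.symm, zero_add]

lemma permImbalance_labRel {m₀ : ℕ} (r : Fin m₀ → Fin m₀ → Prop) (n : ℕ)
    (lab : Fin n → Fin m₀) (hlab : Monotone lab) :
    permImbalance n (labRel r lab) = chainImbalance r n (labCount lab) := by
  induction n with
  | zero => simp [permImbalance, chainImbalance]
  | succ n ih =>
    rw [permImbalance_succ, chainImbalance]
    rw [← sum_filter, ← sum_filter]
    have hpos : ∀ i, 0 < labCount lab i ↔ ∃ x, lab x = i := by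
      intro i
      simp [labCount, card_pos, Finset.Nonempty]
    have hmin : ∀ a, (∀ x, labRel r lab x a → x = a) ↔
        (∀ x, lab x = lab a → a ≤ x) ∧ ∀ k, k ≠ lab a → r k (lab a) → labCount lab k = 0 := by
      intro a
      constructor
      · intro h
        refine ⟨fun x hx => ?_, fun k hk hr => ?_⟩
        · by_contra hlt
          exact hlt (h x (Or.inl ⟨hx, (not_le.1 hlt).le⟩)).ge
        · by_contra hne
          obtain ⟨x, rfl⟩ := (hpos k).1 (Nat.pos_of_ne_zero hne)
          exact hk (congrArg lab (h x (Or.inr ⟨hk, hr⟩)))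
      · rintro ⟨h1, h2⟩ x (⟨hx, hxa⟩ | ⟨hx, hr⟩)
        · exact le_antisymm hxa (h1 x hx)
        · have := (hpos (lab x)).2 ⟨x, rfl⟩
          have := h2 _ hx hr
          omega
    refine sum_bij (fun a _ => lab a) ?_ ?_ ?_ ?_
    · intro a ha
      simp only [mem_filter, mem_univ, true_and] at ha ⊢
      exact ⟨(hpos _).2 ⟨a, rfl⟩, ((hmin a).1 ha).2⟩
    · intro a ha a' ha' h
      simp only [mem_filter, mem_univ, true_and] at ha ha'
      exact le_antisymm (((hmin a).1 ha).1 a' h.symm) (((hmin a').1 ha').1 a h)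
    · intro i hi
      simp only [mem_filter, mem_univ, true_and] at hi
      obtain ⟨x, hx⟩ := (hpos i).1 hi.1
      have hne : (univ.filter fun x => lab x = i).Nonempty := ⟨x, by simpa using hx⟩
      have hmem := min'_mem _ hne
      simp only [mem_filter, mem_univ, true_and] at hmem
      refine ⟨min' _ hne, ?_, hmem⟩
      simp only [mem_filter, mem_univ, true_and]
      rw [hmin, hmem]
      exact ⟨fun y hy => min'_le _ _ (by simpa using hy), hi.2⟩
    · intro a ha
      simp only [mem_filter, mem_univ, true_and] at ha
      have hR : (fun x y => labRel r lab (a.succAbove x) (a.succAbove y)) =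
          labRel r (fun x => lab (a.succAbove x)) := by
        funext x y
        simp [labRel]
      have hsum : ∑ k ∈ Iio (lab a), labCount lab k = a := by
        simp only [labCount]
        rw [sum_card_fiberwise_eq_card_filter]
        rw [← Fin.card_Iio a]
        congr 1
        ext x
        simp only [mem_filter, mem_univ, true_and, mem_Iio]
        exact ⟨fun h => hlab.reflect_lt h, fun h => lt_of_le_of_ne (hlab h.le) fun he =>
          h.not_ge (((hmin a).1 ha).1 x he)⟩
      rw [hR, ih _ (fun x y h => hlab ((Fin.strictMono_succAbove a).monotone h)),
        labCount_succAbove, hsum]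

lemma Lminus_eq_chainImbalance {m₀ : ℕ} (r : Fin m₀ → Fin m₀ → Prop) (m : Fin m₀ → ℕ)
    (b : LexSumChains m₀ m ≃ Fin (∑ i, m i)) (hb : IsRef m b) :
    Lminus m₀ r m b = chainImbalance r (∑ i, m i) m := by
  have hle : ∀ x y : LexSumChains m₀ m, x.1 = y.1 → ((x.2 : ℕ) ≤ y.2 ↔ b x ≤ b y) := by
    intro x y h
    refine ⟨fun hxy => hb x y (Or.inr ⟨h, hxy⟩), fun hxy => ?_⟩
    by_contra hlt
    have := b.injective (le_antisymm hxy (hb y x (Or.inr ⟨h.symm, (not_le.1 hlt).le⟩)))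
    subst this
    exact hlt le_rfl
  have hmono : Monotone fun x => (b.symm x).1 := by
    intro x y hxy
    by_contra hlt
    have h1 := hb (b.symm y) (b.symm x) (Or.inl (not_le.1 hlt))
    simp only [apply_symm_apply] at h1
    exact hlt (by rw [le_antisymm hxy h1])
  have hcount : labCount (fun x => (b.symm x).1) = m := by
    funext i
    have : m i = Fintype.card (Fin (m i)) := by simp
    rw [labCount, this, ← Finset.card_univ]
    symm
    refine card_bij (fun j _ => b ⟨i, j⟩) ?_ ?_ ?_
    · intro j _; simp
    · intro j _ j' _ h
      simpa using h
    · intro x hx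
      simp only [mem_filter, mem_univ, true_and] at hx
      subst hx
      exact ⟨(b.symm x).2, mem_univ _, by simp⟩
  have hG := permImbalance_labRel r _ _ hmono
  rw [hcount] at hG
  rw [← hG, Lminus, permImbalance]
  refine Fintype.sum_equiv (Equiv.equivCongr b (Equiv.refl _)) _ _ fun φ => ?_
  have hiff : IsLin r m φ ↔ ∀ x y, labRel r (fun x => (b.symm x).1) x y →
      (Equiv.equivCongr b (Equiv.refl _) φ) x ≤ (Equiv.equivCongr b (Equiv.refl _) φ) y := by
    constructor
    · intro h x y hxy
      refine h (b.symm x) (b.symm y) (hxy.imp_left fun h' => ⟨h'.1, ?_⟩)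
      rw [hle _ _ h'.1]
      simpa using h'.2
    · intro h x y hxy
      have := h (b x) (b y) (by
        simp only [labRel, symm_apply_apply]
        exact hxy.imp_left fun h' => ⟨h'.1, (hle _ _ h'.1).1 h'.2⟩)
      simpa using this
  simp only [hiff]
  rfl

lemma fwdDiff_iter_zero {h : ℕ} (n : ℕ) : (fwdDiff h)^[n] (0 : ℕ → ℚ) = 0 := by
  induction n with
  | zero => rfl
  | succ n ih =>
    rw [iterate_succ_apply']
    rw [ih]
    funext v
    simp [fwdDiff]

lemma fwdDiff_iter_periodic_mul {h : ℕ} (σ g : ℕ → ℚ) (hσ : ∀ v, σ (v + h) = σ v) (n : ℕ) :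
    (fwdDiff h)^[n] (fun v => σ v * g v) = fun v => σ v * (fwdDiff h)^[n] g v := by
  induction n generalizing g with
  | zero => rfl
  | succ n ih =>
    have : fwdDiff h (fun v => σ v * g v) = fun v => σ v * fwdDiff h g v := by
      funext v
      simp only [fwdDiff, hσ]
      ring
    rw [iterate_succ_apply, this, ih, iterate_succ_apply]

lemma neg_one_pow_sum_update_periodic {ι : Type*} [DecidableEq ι] (T : Finset ι) (m : ι → ℕ)
    (s : ι) (v : ℕ) :
    (-1 : ℚ) ^ (∑ k ∈ T, update m s (v + 2) k) = (-1) ^ (∑ k ∈ T, update m s v k) := by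
  by_cases h : s ∈ T
  · rw [sum_update_of_mem h, sum_update_of_mem h]
    ring
  · rw [sum_update_of_notMem h, sum_update_of_notMem h]

/-- A function of the chain lengths satisfying the recursion of the sign-imbalance is, in each
single length, killed by a power of the difference operator of step `2`; the exponent is controlled
by the number of elements incomparable to the chain. -/
lemma fwdDiff_iter_eq_zero_of_recursion {m₀ : ℕ} (r : Fin m₀ → Fin m₀ → Prop)
    (hr : IsPartialOrder (Fin m₀) r) (F : (Fin m₀ → ℕ) → ℚ)
    (hF : ∀ m, m ≠ 0 → F m = ∑ i, if 0 < m i ∧ ∀ k, k ≠ i → r k i → m k = 0 then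
      (-1) ^ (∑ k ∈ Iio i, m k) * F (update m i (m i - 1)) else 0)
    (s : Fin m₀) (m : Fin m₀ → ℕ) (D : ℕ)
    (hD : ∑ k with k ≠ s ∧ ¬ r k s ∧ ¬ r s k, m k < D) :
    (fwdDiff 2)^[D] (fun v => F (update m s v)) = 0 := by
  induction hN : ∑ k ∈ univ.erase s, m k using Nat.strong_induction_on generalizing m D with
  | _ N ih =>
  subst hN
  set A : Fin m₀ → Prop := fun i =>
    0 < m i ∧ ¬ r s i ∧ ∀ k, k ≠ i → k ≠ s → r k i → m k = 0 with hA
  set T : Fin m₀ → ℕ → ℚ := fun i v => if A i then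
    (-1) ^ (∑ k ∈ Iio i, update m s v k) * F (update (update m i (m i - 1)) s v) else 0 with hT
  have hterm : ∀ i, i ≠ s → ∀ v, (v ≠ 0 ∨ ∃ k, k ≠ s ∧ r k s ∧ m k ≠ 0) →
      (if 0 < update m s v i ∧ ∀ k, k ≠ i → r k i → update m s v k = 0 then
        (-1) ^ (∑ k ∈ Iio i, update m s v k) *
          F (update (update m s v) i (update m s v i - 1)) else 0) = T i v := by
    intro i hi v hv
    have hiff : (0 < update m s v i ∧ ∀ k, k ≠ i → r k i → update m s v k = 0) ↔ A i := by
      rw [update_of_ne hi]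
      constructor
      · rintro ⟨h1, h2⟩
        refine ⟨h1, fun hsi => ?_, fun k hk hks hki => ?_⟩
        · rcases hv with hv | ⟨k, hks, hr1, hk⟩
          · exact hv (by simpa using h2 s hi.symm hsi)
          · have hki : k ≠ i := by
              rintro rfl
              exact hks (hr.antisymm _ _ hr1 hsi)
            have := h2 k hki (hr.trans _ _ _ hr1 hsi)
            rw [update_of_ne hks] at this
            exact hk this
        · have := h2 k hk hki
          rwa [update_of_ne hks] at this
      · rintro ⟨h1, h2, h3⟩
        refine ⟨h1, fun k hk hki => ?_⟩
        have hks : k ≠ s := by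
          rintro rfl
          exact h2 hki
        rw [update_of_ne hks]
        exact h3 k hk hks hki
    simp only [hiff, hT]
    rw [update_of_ne hi, update_comm hi]
  have hTkill : ∀ i, i ≠ s → ∀ D',
      (A i → ∑ k with k ≠ s ∧ ¬ r k s ∧ ¬ r s k, update m i (m i - 1) k < D') →
      (fwdDiff 2)^[D'] (T i) = 0 := by
    intro i hi D' hD'
    by_cases hAi : A i
    · have hlt : ∑ k ∈ univ.erase s, update m i (m i - 1) k < ∑ k ∈ univ.erase s, m k := by
        refine sum_lt_sum (fun k _ => ?_) ⟨i, by simpa using hi, ?_⟩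
        · rcases eq_or_ne k i with rfl | hk
          · simp
          · rw [update_of_ne hk]
        · rw [update_self]
          have := hAi.1
          omega
      have key := ih _ hlt _ D' (hD' hAi) rfl
      have hTi : T i = fun v => (-1) ^ (∑ k ∈ Iio i, update m s v k) *
          F (update (update m i (m i - 1)) s v) := by
        funext v
        simp only [hT, if_pos hAi]
      rw [hTi, fwdDiff_iter_periodic_mul _ _ (neg_one_pow_sum_update_periodic _ m s), key]
      funext v
      simp
    · have hTi : T i = 0 := by
        funext v
        simp only [hT, if_neg hAi, Pi.zero_apply]
      rw [hTi, fwdDiff_iter_zero]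
  have hinc : ∀ i, i ≠ s → A i → ¬ r i s →
      ∑ k with k ≠ s ∧ ¬ r k s ∧ ¬ r s k, update m i (m i - 1) k <
        ∑ k with k ≠ s ∧ ¬ r k s ∧ ¬ r s k, m k := by
    intro i hi hAi his
    refine sum_lt_sum (fun k _ => ?_) ⟨i, by simpa using ⟨hi, his, hAi.2.1⟩, ?_⟩
    · rcases eq_or_ne k i with rfl | hk
      · simp
      · rw [update_of_ne hk]
    · rw [update_self]
      have := hAi.1
      omega
  by_cases hcase : ∃ k, k ≠ s ∧ r k s ∧ m k ≠ 0
  · have hrec : (fun v => F (update m s v)) = ∑ i ∈ univ.erase s, T i := by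
      funext v
      obtain ⟨k, hks, hkr, hk⟩ := hcase
      rw [hF _ (fun h0 => hk (by simpa [update_of_ne hks] using congrFun h0 k)),
        ← add_sum_erase univ _ (mem_univ s), Finset.sum_apply, if_neg, zero_add]
      · exact sum_congr rfl fun i hi => hterm i (ne_of_mem_erase hi) v (Or.inr ⟨k, hks, hkr, hk⟩)
      · rintro ⟨-, h2⟩
        exact hk (by simpa [update_of_ne hks] using h2 k hks hkr)
    rw [hrec, fwdDiff_iter_finsetSum]
    refine sum_eq_zero fun i hi => hTkill i (ne_of_mem_erase hi) D fun hAi => ?_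
    refine lt_of_le_of_lt (sum_le_sum fun k _ => ?_) hD
    rcases eq_or_ne k i with rfl | hk
    · simp
    · rw [update_of_ne hk]
  · have hcase' : ∀ k, k ≠ s → r k s → m k = 0 := by
      intro k hks hkr
      by_contra hk
      exact hcase ⟨k, hks, hkr, hk⟩
    obtain ⟨D, rfl⟩ : ∃ D', D = D' + 1 := ⟨D - 1, by omega⟩
    set g : ℕ → ℚ := ∑ i ∈ univ.erase s, T i with hg
    have hrec : ∀ v, F (update m s (v + 1)) =
        (-1) ^ (∑ k ∈ Iio s, m k) * F (update m s v) + g (v + 1) := by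
      intro v
      rw [hF _ (fun h0 => by simpa using congrFun h0 s), ← add_sum_erase univ _ (mem_univ s),
        hg, Finset.sum_apply, if_pos]
      · congr 1
        · rw [sum_update_of_notMem (by simp)]
          simp
        · exact sum_congr rfl fun i hi => hterm i (ne_of_mem_erase hi) _ (Or.inl v.succ_ne_zero)
      · refine ⟨by simp, fun k hk hkr => ?_⟩
        rw [update_of_ne hk]
        exact hcase' k hk hkr
    have hgkill : (fwdDiff 2)^[D] g = 0 := by
      rw [hg, fwdDiff_iter_finsetSum]
      refine sum_eq_zero fun i hi => hTkill i (ne_of_mem_erase hi) D fun hAi => ?_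
      have his : ¬ r i s := fun h => hAi.1.ne' (hcase' i (ne_of_mem_erase hi) h)
      have := hinc i (ne_of_mem_erase hi) hAi his
      omega
    set ε : ℚ := (-1) ^ (∑ k ∈ Iio s, m k) with hε
    have hε2 : ε * ε = 1 := by
      rw [hε, ← mul_pow]
      simp
    have hstep : fwdDiff 2 (fun v => F (update m s v)) =
        ε • (fun v => g (v + 1)) + fun v => g (v + 2) := by
      funext v
      simp only [fwdDiff, Pi.add_apply, Pi.smul_apply, smul_eq_mul]
      rw [hrec (v + 1), hrec v]
      linear_combination F (update m s v) * hε2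
    rw [iterate_succ_apply, hstep, fwdDiff_iter_add, fwdDiff_iter_const_smul]
    funext v
    simp [fwdDiff_iter_comp_add, hgkill]

/-- A function of natural numbers `v j` that is given by one polynomial for each choice of the
parities of the `v j`. -/
def IsParityPolynomial {ι : Type*} (f : (ι → ℕ) → ℚ) : Prop :=
  ∃ F : (ι → Bool) → MvPolynomial ι ℚ,
    ∀ v, f v = MvPolynomial.eval (fun j => (v j : ℚ)) (F fun j => decide (Odd (v j)))

namespace IsParityPolynomial

variable {ι : Type*}

lemma const (c : ℚ) : IsParityPolynomial fun _ : ι → ℕ => c :=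
  ⟨fun _ => MvPolynomial.C c, fun v => by simp⟩

lemma mul {f g : (ι → ℕ) → ℚ} (hf : IsParityPolynomial f) (hg : IsParityPolynomial g) :
    IsParityPolynomial fun v => f v * g v := by
  obtain ⟨F, hF⟩ := hf
  obtain ⟨G, hG⟩ := hg
  exact ⟨fun p => F p * G p, fun v => by simp [hF, hG]⟩

lemma sum {κ : Type*} (s : Finset κ) {f : κ → (ι → ℕ) → ℚ}
    (hf : ∀ k, IsParityPolynomial (f k)) : IsParityPolynomial fun v => ∑ k ∈ s, f k v := by
  choose F hF using hf
  exact ⟨fun p => ∑ k ∈ s, F k p, fun v => by simp [hF]⟩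

lemma of_mod_two (j : ι) {f : ℕ → (ι → ℕ) → ℚ} (hf : ∀ e, IsParityPolynomial (f e)) :
    IsParityPolynomial fun v => f (v j % 2) v := by
  choose F hF using hf
  refine ⟨fun p => F (if p j then 1 else 0) p, fun v => ?_⟩
  simp only [hF]
  rcases Nat.even_or_odd (v j) with h | h
  · rw [Nat.even_iff.1 h, if_neg (by simpa using h)]
  · rw [Nat.odd_iff.1 h, if_pos (by simpa using h)]

lemma choose_div_two (j : ι) (k : ℕ) :
    IsParityPolynomial fun v : ι → ℕ => (((v j / 2).choose k : ℕ) : ℚ) := by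
  have hpoly : ∀ e : ℕ, IsParityPolynomial fun v : ι → ℕ =>
      (descPochhammer ℚ k).eval (((v j : ℚ) - e) / 2) / k.factorial := by
    intro e
    refine ⟨fun _ => MvPolynomial.C ((k.factorial : ℚ)⁻¹) * Polynomial.eval₂ MvPolynomial.C
      (MvPolynomial.C 2⁻¹ * (MvPolynomial.X j - MvPolynomial.C (e : ℚ))) (descPochhammer ℚ k),
      fun v => ?_⟩
    rw [map_mul, Polynomial.hom_eval₂]
    have : (MvPolynomial.eval fun j => (v j : ℚ)).comp MvPolynomial.C = RingHom.id ℚ := by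
      ext; simp
    rw [this, Polynomial.eval₂_id]
    simp only [MvPolynomial.eval_C, map_mul, map_sub, MvPolynomial.eval_X]
    rw [div_eq_inv_mul, div_eq_inv_mul]
  convert! of_mod_two j hpoly using 2 with v
  rw [Nat.cast_choose_eq_descPochhammer_div]
  congr 2
  have h : ((v j % 2 + 2 * (v j / 2) : ℕ) : ℚ) = v j := by rw [Nat.mod_add_div]
  push_cast at h ⊢
  linarith

end IsParityPolynomial

lemma eq_sum_choose_of_fwdDiff_iter_eq_zero (h : ℕ) (g : ℕ → ℚ) (D : ℕ)
    (hg : (fwdDiff h)^[D] g = 0) (e n : ℕ) :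
    g (e + n * h) = ∑ k ∈ range D, (n.choose k : ℚ) *
      ∑ l ∈ range (k + 1), ((-1) ^ (k - l) * k.choose l : ℚ) * g (e + l * h) := by
  have hz : ∀ k, D ≤ k → (fwdDiff h)^[k] g = 0 := by
    intro k hk
    obtain ⟨c, rfl⟩ := Nat.exists_eq_add_of_le' hk
    rw [iterate_add_apply, hg, fwdDiff_iter_zero]
  have hd : ∀ k, (fwdDiff h)^[k] g e =
      ∑ l ∈ range (k + 1), ((-1) ^ (k - l) * k.choose l : ℚ) * g (e + l * h) := by
    intro k
    rw [fwdDiff_iter_eq_sum_shift]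
    refine sum_congr rfl fun l _ => ?_
    simp
  have h1 := shift_eq_sum_fwdDiff_iter h g n e
  simp only [smul_eq_mul, nsmul_eq_mul] at h1
  rw [h1]
  simp only [← hd]
  trans ∑ k ∈ range (n + 1 + D), (n.choose k : ℚ) * (fwdDiff h)^[k] g e
  · refine sum_subset (range_mono (by omega)) fun k _ hk => ?_
    rw [Nat.choose_eq_zero_of_lt (by simpa using hk)]
    simp
  · symm
    refine sum_subset (range_mono (by omega)) fun k _ hk => ?_
    rw [hz k (by simpa using hk)]
    simp

/-- A function depending on finitely many variables, and killed in each of them by a power of the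
difference operator of step `2`, is given by polynomials on the parity classes. -/
lemma isParityPolynomial_of_fwdDiff {ι : Type*} [DecidableEq ι] (T : Finset ι)
    (f : (ι → ℕ) → ℚ) (hdep : ∀ v w, (∀ j ∈ T, v j = w j) → f v = f w)
    (hf : ∀ j ∈ T, ∃ D, ∀ v, (fwdDiff 2)^[D] (fun t => f (update v j t)) = 0) :
    IsParityPolynomial f := by
  induction T using Finset.induction_on generalizing f with
  | empty =>
    have : f = fun _ => f 0 := funext fun v => hdep v 0 (by simp)
    rw [this]
    exact IsParityPolynomial.const _
  | insert j T hj ih =>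
    obtain ⟨D, hD⟩ := hf j (mem_insert_self _ _)
    have hsub : ∀ c, IsParityPolynomial fun v => f (update v j c) := by
      intro c
      apply ih
      · intro v w hvw
        apply hdep
        intro i hi
        rcases eq_or_ne i j with rfl | hij
        · simp
        · rw [update_of_ne hij, update_of_ne hij]
          exact hvw i (mem_of_mem_insert_of_ne hi hij)
      · intro i hi
        obtain ⟨D', hD'⟩ := hf i (mem_insert_of_mem hi)
        have hij : i ≠ j := fun h => hj (h ▸ hi)
        refine ⟨D', fun v => ?_⟩
        rw [← hD' (update v j c)]
        congr 1
        funext t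
        rw [update_comm hij]
    have hexp : f = fun v => ∑ k ∈ range D, ((v j / 2).choose k : ℚ) *
        ∑ l ∈ range (k + 1), ((-1) ^ (k - l) * k.choose l : ℚ) *
          f (update v j (v j % 2 + l * 2)) := by
      funext v
      rw [← eq_sum_choose_of_fwdDiff_iter_eq_zero 2 (fun t => f (update v j t)) D (hD v),
        Nat.mod_add_div', update_eq_self]
    rw [hexp]
    refine IsParityPolynomial.sum _ fun k => (IsParityPolynomial.choose_div_two j k).mul ?_
    refine IsParityPolynomial.sum _ fun l => (IsParityPolynomial.const _).mul ?_
    exact IsParityPolynomial.of_mod_two (f := fun e v => f (update v j (e + l * 2))) j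
      fun e => hsub _

lemma chainImbalance_sum_eq {m₀ : ℕ} (r : Fin m₀ → Fin m₀ → Prop) (m : Fin m₀ → ℕ) (hm : m ≠ 0) :
    chainImbalance r (∑ i, m i) m =
      ∑ i, if 0 < m i ∧ ∀ k, k ≠ i → r k i → m k = 0 then (-1) ^ (∑ k ∈ Iio i, m k) *
        chainImbalance r (∑ k, update m i (m i - 1) k) (update m i (m i - 1)) else 0 := by
  obtain ⟨n, hn⟩ : ∃ n, ∑ i, m i = n + 1 := by
    refine Nat.exists_eq_succ_of_ne_zero fun h => hm ?_
    funext i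
    exact (sum_eq_zero_iff.1 h) i (mem_univ i)
  rw [hn, chainImbalance]
  refine sum_congr rfl fun i _ => ?_
  split_ifs with h
  · have hsum : ∑ k, update m i (m i - 1) k = n := by
      have h1 := sum_update_of_mem (mem_univ i) m (m i - 1)
      have h2 := sum_update_of_mem (mem_univ i) m (m i)
      rw [update_eq_self] at h2
      omega
    rw [hsum]
  · rfl

/-- Corollary to the proof of the theorem. If `S` is a chain in `P₀` and the
values `mᵢ` with `xᵢ ∉ S` are fixed, then the values of the sign-imbalance `L₋(P₀; m₁,…,m_{m₀})`
as a function of the variables `mᵢ` with `xᵢ ∈ S` are given by `2^card S` polynomials, one for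
each choice of the parities of those `card S` variables. -/
theorem lexSum_signImbalance_polynomials_in_chain_variables (m₀ : ℕ)
    (r0 : Fin m₀ → Fin m₀ → Prop) (hr0 : IsPartialOrder (Fin m₀) r0)
    (S : Finset (Fin m₀)) (hS : IsChain r0 (↑S : Set (Fin m₀))) (m : Fin m₀ → ℕ) :
    ∃ F : ({i : Fin m₀ // i ∈ S} → Bool) → MvPolynomial {i : Fin m₀ // i ∈ S} ℚ,
      ∀ v : {i : Fin m₀ // i ∈ S} → ℕ,
        ∀ b : LexSumChains m₀ (fun i => if h : i ∈ S then v ⟨i, h⟩ else m i) ≃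
                Fin (∑ i, if h : i ∈ S then v ⟨i, h⟩ else m i),
          IsRef (fun i => if h : i ∈ S then v ⟨i, h⟩ else m i) b →
            (Lminus m₀ r0 (fun i => if h : i ∈ S then v ⟨i, h⟩ else m i) b : ℚ) =
              MvPolynomial.eval (fun j => (v j : ℚ)) (F (fun j => decide (Odd (v j)))) := by
  set mm : ({i : Fin m₀ // i ∈ S} → ℕ) → Fin m₀ → ℕ :=
    fun v i => if h : i ∈ S then v ⟨i, h⟩ else m i with hmm
  have hupd : ∀ v j t, mm (update v j t) = update (mm v) j.1 t := by
    intro v j t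
    funext i
    rcases eq_or_ne i j.1 with rfl | hi
    · simp [hmm]
    · rw [update_of_ne hi]
      simp only [hmm]
      split_ifs with h
      · rw [update_of_ne (fun h' => hi (congrArg Subtype.val h'))]
      · rfl
  have key : IsParityPolynomial fun v => (chainImbalance r0 (∑ i, mm v i) (mm v) : ℚ) := by
    refine isParityPolynomial_of_fwdDiff univ _ (fun v w h => ?_) fun j _ => ?_
    · rw [funext fun j => h j (mem_univ j)]
    · refine ⟨∑ k with k ≠ j.1 ∧ ¬ r0 k j.1 ∧ ¬ r0 j.1 k, m k + 1, fun v => ?_⟩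
      simp only [hupd]
      refine fwdDiff_iter_eq_zero_of_recursion r0 hr0
        (fun m => (chainImbalance r0 (∑ i, m i) m : ℚ)) (fun m hm => ?_) j.1 (mm v) _ ?_
      · rw [chainImbalance_sum_eq r0 m hm]
        push_cast
        rfl
      · refine Nat.lt_succ_of_le (sum_le_sum fun k hk => ?_)
        simp only [mem_filter, mem_univ, true_and] at hk
        have hkS : k ∉ S := fun h => (hS h j.2 hk.1).elim hk.2.1 hk.2.2
        simp [hmm, hkS]
  obtain ⟨F, hF⟩ := key
  exact ⟨F, fun v b hb => by rw [← hF, Lminus_eq_chainImbalance r0 _ b hb]⟩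
end
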